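/- arXiv:2312.15689 — 4 statements merged into one kernel-verified Lean document; each statement's English description precedes it below -/
import Mathlib

section
/- Let N ≥ 1 be an integer and let u ∈ L^1_0(ℝ^N). Define W_u : ℝ^N × ℝ² ∖ (ℝ^N × {0}) → ℝ by W_u(x,y) = w_u(x,|y|). Then for every test function Φ ∈ C_c^∞(ℝ^{N+2}), ∫_{ℝ^N × ℝ²} W_u(x,y) ΔΦ(x,y) dx dy = −2π ∫_{ℝ^N} u(x) Φ(x,(0,0)) dx; that is, −Δ W_u = 2π u ℒ^N ⊗ δ_{(0,0)} in ℝ^{N+2} in the distributional sense. -/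
open MeasureTheory Real Filter Topology Set Metric

noncomputable section

/-- The normalization constant `c_N = Γ(N/2)/π^(N/2)`. -/
def cN (N : ℕ) : ℝ := Real.Gamma ((N : ℝ) / 2) / Real.pi ^ ((N : ℝ) / 2)

/-- Membership in the space `L^1_0(ℝ^N)`. -/
def MemL10 (N : ℕ) (u : EuclideanSpace ℝ (Fin N) → ℝ) : Prop :=
  MeasureTheory.LocallyIntegrable u volume ∧
    MeasureTheory.Integrable (fun x => (1 + ‖x‖) ^ (-(N : ℝ)) * |u x|) volume

/-- The Poisson-type extension `w_u`. -/
def poissonExt (N : ℕ) (u : EuclideanSpace ℝ (Fin N) → ℝ)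
    (x : EuclideanSpace ℝ (Fin N)) (t : ℝ) : ℝ :=
  (cN N / 2) * ∫ y, u y * (‖x - y‖ ^ 2 + t ^ 2) ^ (-(N : ℝ) / 2)

/-- The doubled Euclidean space `ℝ^N × ℝ²`, with its product (sup) norm. -/
abbrev DoubledSpace (N : ℕ) : Type :=
  EuclideanSpace ℝ (Fin N) × EuclideanSpace ℝ (Fin 2)

theorem finrank_doubledSpace (N : ℕ) : Module.finrank ℝ (DoubledSpace N) = N + 2 := by
  simp

instance (N : ℕ) : (volume : Measure (DoubledSpace N)).IsAddHaarMeasure :=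
  inferInstanceAs ((volume : Measure (EuclideanSpace ℝ (Fin N))).prod
    (volume : Measure (EuclideanSpace ℝ (Fin 2)))).IsAddHaarMeasure

/-- The squared Euclidean norm on `ℝ^N × ℝ²`, shifted by `ε²`. -/
def shiftedSq (N : ℕ) (ε : ℝ) (p : DoubledSpace N) : ℝ := ‖p.1‖ ^ 2 + ‖p.2‖ ^ 2 + ε ^ 2

theorem norm_sq_le_shiftedSq {N : ℕ} (ε : ℝ) (p : DoubledSpace N) :
    ‖p‖ ^ 2 + ε ^ 2 ≤ shiftedSq N ε p := by
  unfold shiftedSq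
  rcases max_choice ‖p.1‖ ‖p.2‖ with h | h <;> rw [Prod.norm_def, h] <;>
    nlinarith [sq_nonneg ‖p.1‖, sq_nonneg ‖p.2‖]

theorem shiftedSq_pos {N : ℕ} {ε : ℝ} (hε : ε ≠ 0) (p : DoubledSpace N) :
    0 < shiftedSq N ε p := by
  unfold shiftedSq; positivity

theorem contDiff_shiftedSq (N : ℕ) (ε : ℝ) : ContDiff ℝ (⊤ : ℕ∞) (shiftedSq N ε) := by
  unfold shiftedSq
  exact ((contDiff_fst.norm_sq ℝ).add (contDiff_snd.norm_sq ℝ)).add contDiff_const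

theorem contDiff_shiftedSq_rpow (N : ℕ) {ε : ℝ} (hε : ε ≠ 0) (s : ℝ) :
    ContDiff ℝ (⊤ : ℕ∞) (fun p => shiftedSq N ε p ^ s) :=
  (contDiff_shiftedSq N ε).rpow_const_of_ne fun p => (shiftedSq_pos hε p).ne'

theorem tendsto_const_add_sq_rpow_neg (a : ℝ) {s : ℝ} (hs : 0 < s) :
    Tendsto (fun r : ℝ => (a + r ^ 2) ^ (-s)) atTop (𝓝 0) :=
  (tendsto_rpow_neg_atTop hs).comp
    (tendsto_atTop_add_const_left _ _ (tendsto_pow_atTop two_ne_zero))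

/-- The radial integral of a shifted power over the plane. -/
theorem integral_plane_rpow {a s : ℝ} (ha : 0 < a) (hs : 0 < s) :
    ∫ y : EuclideanSpace ℝ (Fin 2), (a + ‖y‖ ^ 2) ^ (-s - 1) = π * a ^ (-s) / s := by
  rw [integral_fun_norm_addHaar volume (fun r => (a + r ^ 2) ^ (-s - 1))]
  have hd : ∀ r ∈ Ici (0 : ℝ), HasDerivAt (fun r : ℝ => -(a + r ^ 2) ^ (-s) / (2 * s))
      (r ^ 1 * (a + r ^ 2) ^ (-s - 1)) r := by
    intro r _
    have h1 : HasDerivAt (fun r : ℝ => a + r ^ 2) (2 * r) r := by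
      simpa using (hasDerivAt_pow 2 r).const_add a
    have h2 := ((h1.rpow_const (p := -s) (Or.inl (by positivity))).neg).div_const (2 * s)
    refine h2.congr_deriv ?_
    field_simp
  have hlim : Tendsto (fun r : ℝ => -(a + r ^ 2) ^ (-s) / (2 * s)) atTop (𝓝 0) := by
    simpa using ((tendsto_const_add_sq_rpow_neg a hs).neg).div_const (2 * s)
  have := integral_Ioi_of_hasDerivAt_of_nonneg' hd
    (fun r hr => by have : (0 : ℝ) < r := hr; positivity) hlim
  simp only [finrank_euclideanSpace, Fintype.card_fin, smul_eq_mul, nsmul_eq_mul]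
  rw [this]
  have hball : (volume : Measure (EuclideanSpace ℝ (Fin 2))).real (ball 0 1) = π := by
    simp [Measure.real, pi_pos.le]
  rw [hball]
  norm_num
  field_simp

/-- The conformally critical integral over `ℝ^N` equals the volume of the unit ball. -/
theorem integral_one_add_norm_sq_rpow {N : ℕ} (hN : 1 ≤ N) :
    ∫ x : EuclideanSpace ℝ (Fin N), (1 + ‖x‖ ^ 2) ^ (-((N : ℝ) + 2) / 2)
      = π ^ ((N : ℝ) / 2) / Real.Gamma ((N : ℝ) / 2 + 1) := by
  have : Nonempty (Fin N) := ⟨⟨0, hN⟩⟩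
  have hN' : (0 : ℝ) < N := by exact_mod_cast hN
  rw [integral_fun_norm_addHaar volume (fun r => (1 + r ^ 2) ^ (-((N : ℝ) + 2) / 2))]
  have hd : ∀ r ∈ Ici (0 : ℝ), HasDerivAt
      (fun r : ℝ => r ^ N * (1 + r ^ 2) ^ (-(N : ℝ) / 2) / N)
      (r ^ (N - 1) * (1 + r ^ 2) ^ (-((N : ℝ) + 2) / 2)) r := by
    intro r _
    have h1 : HasDerivAt (fun r : ℝ => 1 + r ^ 2) (2 * r) r := by
      simpa using (hasDerivAt_pow 2 r).const_add 1
    have h2 := ((hasDerivAt_pow N r).mul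
      (h1.rpow_const (p := -(N : ℝ) / 2) (Or.inl (by positivity)))).div_const (N : ℝ)
    refine h2.congr_deriv ?_
    have e1 : (1 + r ^ 2) ^ (-(N : ℝ) / 2)
        = (1 + r ^ 2) ^ (-((N : ℝ) + 2) / 2) * (1 + r ^ 2) := by
      rw [← rpow_add_one (by positivity)]; congr 1; ring
    have e2 : -(N : ℝ) / 2 - 1 = -((N : ℝ) + 2) / 2 := by ring
    have e3 : r ^ N = r ^ (N - 1) * r := by rw [← pow_succ, Nat.sub_add_cancel hN]
    rw [e2, e1, e3]
    field_simp
    ring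
  have hlim : Tendsto (fun r : ℝ => r ^ N * (1 + r ^ 2) ^ (-(N : ℝ) / 2) / N) atTop
      (𝓝 (1 / (N : ℝ))) := by
    refine Tendsto.div_const ?_ _
    have h0 : Tendsto (fun r : ℝ => ((r ^ 2)⁻¹ + 1) ^ (-(N : ℝ) / 2)) atTop (𝓝 1) := by
      have h3 : Tendsto (fun r : ℝ => (r ^ 2)⁻¹ + 1) atTop (𝓝 (0 + 1)) :=
        (tendsto_inv_atTop_zero.comp (tendsto_pow_atTop two_ne_zero)).add_const 1
      simpa using h3.rpow_const (p := -(N : ℝ) / 2) (Or.inl (by norm_num))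
    refine h0.congr' ?_
    filter_upwards [eventually_gt_atTop 0] with r hr
    have e : (1 : ℝ) + r ^ 2 = r ^ 2 * ((r ^ 2)⁻¹ + 1) := by field_simp
    have e' : (r ^ 2 : ℝ) ^ (-(N : ℝ) / 2) = (r ^ N)⁻¹ := by
      rw [← rpow_natCast, ← rpow_mul hr.le, ← rpow_natCast, ← rpow_neg hr.le]
      congr 1; push_cast; ring
    rw [e, mul_rpow (by positivity) (by positivity), e']
    field_simp
  have := integral_Ioi_of_hasDerivAt_of_nonneg' hd
    (fun r hr => by have : (0 : ℝ) < r := hr; positivity) hlim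
  simp only [finrank_euclideanSpace, Fintype.card_fin, smul_eq_mul, nsmul_eq_mul]
  rw [this, zero_pow (by omega)]
  have hball : (volume : Measure (EuclideanSpace ℝ (Fin N))).real (ball 0 1)
      = π ^ ((N : ℝ) / 2) / Real.Gamma ((N : ℝ) / 2 + 1) := by
    have hg : 0 < Real.Gamma ((N : ℝ) / 2 + 1) := Real.Gamma_pos_of_pos (by positivity)
    have e : √π ^ N = π ^ ((N : ℝ) / 2) := by
      rw [sqrt_eq_rpow, ← rpow_natCast, ← rpow_mul pi_pos.le]; congr 1; ring
    simp only [Measure.real, EuclideanSpace.volume_ball, Fintype.card_fin, e]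
    rw [ENNReal.toReal_mul, ENNReal.toReal_ofReal (by positivity)]
    simp
  rw [hball]
  field_simp
  ring

theorem integrable_shiftedSq_one_rpow (N : ℕ) :
    Integrable (fun p : DoubledSpace N => shiftedSq N 1 p ^ (-((N : ℝ) + 4) / 2)) := by
  have h := integrable_rpow_neg_one_add_norm_sq (E := DoubledSpace N) (μ := volume)
    (r := (N : ℝ) + 4) (by rw [finrank_doubledSpace]; push_cast; linarith)
  refine h.mono' (contDiff_shiftedSq_rpow N one_ne_zero _).continuous.aestronglyMeasurable ?_
  refine ae_of_all _ fun p => ?_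
  have h1 := shiftedSq_pos one_ne_zero p
  rw [Real.norm_of_nonneg (by positivity)]
  refine rpow_le_rpow_of_nonpos (by positivity) ?_ (by
    have : (0 : ℝ) ≤ N := N.cast_nonneg
    linarith)
  have := norm_sq_le_shiftedSq 1 p
  linarith

theorem integral_shiftedSq_one_rpow {N : ℕ} (hN : 1 ≤ N) :
    (N : ℝ) * (N + 2) * ∫ p : DoubledSpace N, shiftedSq N 1 p ^ (-((N : ℝ) + 4) / 2)
      = 4 * π / cN N := by
  have hN' : (0 : ℝ) < N := by exact_mod_cast hN
  rw [Measure.volume_eq_prod, integral_prod _ (integrable_shiftedSq_one_rpow N)]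
  have h : ∀ x : EuclideanSpace ℝ (Fin N), ∫ y : EuclideanSpace ℝ (Fin 2),
      shiftedSq N 1 (x, y) ^ (-((N : ℝ) + 4) / 2)
      = π / (((N : ℝ) + 2) / 2) * (1 + ‖x‖ ^ 2) ^ (-((N : ℝ) + 2) / 2) := by
    intro x
    have := integral_plane_rpow (a := 1 + ‖x‖ ^ 2) (s := ((N : ℝ) + 2) / 2) (by positivity)
      (by positivity)
    rw [div_mul_eq_mul_div, neg_div 2 ((N : ℝ) + 2), ← this]
    congr 1; ext y
    simp only [shiftedSq]
    congr 1 <;> ring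
  simp_rw [h]
  rw [integral_const_mul, integral_one_add_norm_sq_rpow hN, cN,
    Real.Gamma_add_one (by positivity)]
  have hg : 0 < Real.Gamma ((N : ℝ) / 2) := Real.Gamma_pos_of_pos (by positivity)
  field_simp
  ring

/-- The coordinate directions of `ℝ^N × ℝ²`. -/
def coordDir (N : ℕ) : Fin N ⊕ Fin 2 → DoubledSpace N :=
  Sum.elim (fun i => (EuclideanSpace.single i 1, 0)) (fun j => (0, EuclideanSpace.single j 1))

/-- The coordinate functionals of `ℝ^N × ℝ²`. -/
def coordFun (N : ℕ) : Fin N ⊕ Fin 2 → DoubledSpace N →L[ℝ] ℝ :=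
  Sum.elim
    (fun i => (EuclideanSpace.proj i : EuclideanSpace ℝ (Fin N) →L[ℝ] ℝ).comp
      (ContinuousLinearMap.fst ℝ _ _))
    (fun j => (EuclideanSpace.proj j : EuclideanSpace ℝ (Fin 2) →L[ℝ] ℝ).comp
      (ContinuousLinearMap.snd ℝ _ _))

theorem coordFun_coordDir {N : ℕ} (k : Fin N ⊕ Fin 2) : coordFun N k (coordDir N k) = 1 := by
  rcases k with i | j <;> simp [coordFun, coordDir]

theorem sum_coordFun_sq {N : ℕ} (p : DoubledSpace N) :
    ∑ k, coordFun N k p ^ 2 = ‖p.1‖ ^ 2 + ‖p.2‖ ^ 2 := by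
  simp [Fintype.sum_sum_type, coordFun, EuclideanSpace.real_norm_sq_eq]

/-- The second directional derivative along `e`. -/
def dirDeriv₂ {N : ℕ} (e : DoubledSpace N) (f : DoubledSpace N → ℝ) (p : DoubledSpace N) : ℝ :=
  fderiv ℝ (fun q => fderiv ℝ f q e) p e

/-- The Laplacian of `ℝ^N × ℝ²` as a sum of second directional derivatives. -/
def coordLaplacian {N : ℕ} (f : DoubledSpace N → ℝ) (p : DoubledSpace N) : ℝ :=
  ∑ k, dirDeriv₂ (coordDir N k) f p

section Smooth

variable {N : ℕ} {f g : DoubledSpace N → ℝ}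

theorem contDiff_fderiv_apply (hf : ContDiff ℝ (⊤ : ℕ∞) f) (e : DoubledSpace N) :
    ContDiff ℝ (⊤ : ℕ∞) (fun q => fderiv ℝ f q e) :=
  (hf.fderiv_right (m := (⊤ : ℕ∞)) (by simp)).clm_apply contDiff_const

theorem hasCompactSupport_fderiv_apply (hf : HasCompactSupport f) (e : DoubledSpace N) :
    HasCompactSupport (fun q => fderiv ℝ f q e) :=
  hf.fderiv_apply ℝ e

theorem continuous_dirDeriv₂ (hf : ContDiff ℝ (⊤ : ℕ∞) f) (e : DoubledSpace N) :
    Continuous (dirDeriv₂ e f) :=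
  (contDiff_fderiv_apply (contDiff_fderiv_apply hf e) e).continuous

theorem hasCompactSupport_dirDeriv₂ (hf : HasCompactSupport f) (e : DoubledSpace N) :
    HasCompactSupport (dirDeriv₂ e f) :=
  hasCompactSupport_fderiv_apply (hasCompactSupport_fderiv_apply hf e) e

theorem continuous_coordLaplacian (hf : ContDiff ℝ (⊤ : ℕ∞) f) :
    Continuous (coordLaplacian f) :=
  continuous_finsetSum _ fun _ _ => continuous_dirDeriv₂ hf _

theorem hasCompactSupport_coordLaplacian (hf : HasCompactSupport f) :
    HasCompactSupport (coordLaplacian f) := by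
  refine HasCompactSupport.of_support_subset_isCompact hf fun p hp => ?_
  by_contra h
  refine hp (Finset.sum_eq_zero fun k _ => ?_)
  have hz : f =ᶠ[𝓝 p] 0 := notMem_tsupport_iff_eventuallyEq.mp h
  have h1 : (fun q => fderiv ℝ f q (coordDir N k)) =ᶠ[𝓝 p] fun _ => 0 := by
    filter_upwards [hz.fderiv (𝕜 := ℝ)] with q hq
    rw [hq]; simp
  simp [dirDeriv₂, h1.fderiv_eq]

theorem iteratedDeriv_two_line (hf : ContDiff ℝ (⊤ : ℕ∞) f) (p e : DoubledSpace N) :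
    iteratedDeriv 2 (fun s : ℝ => f (p + s • e)) 0 = dirDeriv₂ e f p := by
  have hline : ∀ s : ℝ, HasDerivAt (fun s : ℝ => p + s • e) e s := fun s => by
    simpa using ((hasDerivAt_id s).smul_const e).const_add p
  have key : ∀ {g : DoubledSpace N → ℝ}, ContDiff ℝ (⊤ : ℕ∞) g → ∀ s : ℝ,
      deriv (fun s : ℝ => g (p + s • e)) s = fderiv ℝ g (p + s • e) e := fun hg s =>
    ((hg.differentiable (by simp) _).hasFDerivAt.comp_hasDerivAt s (hline s)).deriv
  rw [iteratedDeriv_succ, iteratedDeriv_one, funext (key hf),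
    key (contDiff_fderiv_apply hf e), zero_smul, add_zero, dirDeriv₂]

theorem integral_mul_dirDeriv₂ (hf : ContDiff ℝ (⊤ : ℕ∞) f) (hg : ContDiff ℝ (⊤ : ℕ∞) g)
    (hgc : HasCompactSupport g) (e : DoubledSpace N) :
    ∫ p, f p * dirDeriv₂ e g p = ∫ p, dirDeriv₂ e f p * g p := by
  have hf1 := contDiff_fderiv_apply hf e
  have hg1 := contDiff_fderiv_apply hg e
  have hgc1 := hasCompactSupport_fderiv_apply hgc e
  have hI : ∀ {a b : DoubledSpace N → ℝ}, Continuous a → Continuous b → HasCompactSupport b →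
      Integrable (fun p => a p * b p) := fun ha hb hbc =>
    (ha.mul hb).integrable_of_hasCompactSupport hbc.mul_left
  unfold dirDeriv₂
  rw [integral_mul_fderiv_eq_neg_fderiv_mul_of_integrable (hI hf1.continuous hg1.continuous hgc1)
      (hI hf.continuous (continuous_dirDeriv₂ hg e) (hasCompactSupport_dirDeriv₂ hgc e))
      (hI hf.continuous hg1.continuous hgc1)
      (fun p _ => hf.differentiable (by simp) p) (fun p _ => hg1.differentiable (by simp) p),
    integral_mul_fderiv_eq_neg_fderiv_mul_of_integrable
      (hI (continuous_dirDeriv₂ hf e) hg.continuous hgc)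
      (hI hf1.continuous hg1.continuous hgc1) (hI hf1.continuous hg.continuous hgc)
      (fun p _ => hf1.differentiable (by simp) p) (fun p _ => hg.differentiable (by simp) p),
    neg_neg]

/-- Green's identity against a test function. -/
theorem integral_mul_coordLaplacian (hf : ContDiff ℝ (⊤ : ℕ∞) f) (hg : ContDiff ℝ (⊤ : ℕ∞) g)
    (hgc : HasCompactSupport g) :
    ∫ p, f p * coordLaplacian g p = ∫ p, coordLaplacian f p * g p := by
  simp only [coordLaplacian, Finset.mul_sum, Finset.sum_mul]
  rw [integral_finsetSum, integral_finsetSum]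
  · exact Finset.sum_congr rfl fun k _ => integral_mul_dirDeriv₂ hf hg hgc _
  · exact fun k _ => ((continuous_dirDeriv₂ hf _).mul hg.continuous).integrable_of_hasCompactSupport
      hgc.mul_left
  · exact fun k _ => (hf.continuous.mul (continuous_dirDeriv₂ hg _)).integrable_of_hasCompactSupport
      (hasCompactSupport_dirDeriv₂ hgc _).mul_left

end Smooth

theorem fderiv_shiftedSq_rpow_apply {N : ℕ} {ε : ℝ} (hε : ε ≠ 0) (s : ℝ) (k : Fin N ⊕ Fin 2)
    (p : DoubledSpace N) :
    fderiv ℝ (fun q => shiftedSq N ε q ^ s) p (coordDir N k)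
      = 2 * s * (coordFun N k p * shiftedSq N ε p ^ (s - 1)) := by
  have h1 : HasFDerivAt (fun q : DoubledSpace N => ‖q.1‖ ^ 2) _ p :=
    (hasFDerivAt_fst (𝕜 := ℝ) (p := p)).norm_sq
  have h2 : HasFDerivAt (fun q : DoubledSpace N => ‖q.2‖ ^ 2) _ p :=
    (hasFDerivAt_snd (𝕜 := ℝ) (p := p)).norm_sq
  have h3 : HasFDerivAt (shiftedSq N ε) _ p := (h1.add h2).add_const (ε ^ 2)
  rw [(h3.rpow_const (p := s) (Or.inl (shiftedSq_pos hε p).ne')).fderiv]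
  rcases k with i | j <;> simp [coordDir, coordFun, EuclideanSpace.inner_single_right] <;> ring

theorem dirDeriv₂_shiftedSq_rpow {N : ℕ} {ε : ℝ} (hε : ε ≠ 0) (s : ℝ) (k : Fin N ⊕ Fin 2)
    (p : DoubledSpace N) :
    dirDeriv₂ (coordDir N k) (fun q => shiftedSq N ε q ^ s) p
      = 2 * s * shiftedSq N ε p ^ (s - 1)
        + 4 * s * (s - 1) * coordFun N k p ^ 2 * shiftedSq N ε p ^ (s - 2) := by
  have h1 := (coordFun N k).hasFDerivAt (x := p)
  have h2 := ((contDiff_shiftedSq_rpow N hε (s - 1)).differentiable (by simp) p).hasFDerivAt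
  unfold dirDeriv₂
  simp_rw [fderiv_shiftedSq_rpow_apply hε]
  have h3 : HasFDerivAt
      (fun q => 2 * s * (coordFun N k q * shiftedSq N ε q ^ (s - 1))) _ p :=
    (h1.mul h2).const_mul (2 * s)
  rw [h3.fderiv]
  simp only [_root_.smul_apply, _root_.add_apply, smul_eq_mul,
    fderiv_shiftedSq_rpow_apply hε, coordFun_coordDir, show s - 1 - 1 = s - 2 by ring]
  ring

theorem coordLaplacian_shiftedSq_rpow {N : ℕ} {ε : ℝ} (hε : ε ≠ 0) (p : DoubledSpace N) :
    coordLaplacian (fun q => shiftedSq N ε q ^ (-(N : ℝ) / 2)) p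
      = -((N : ℝ) * (N + 2)) * ε ^ 2 * shiftedSq N ε p ^ (-((N : ℝ) + 4) / 2) := by
  have hQ := shiftedSq_pos hε p
  have hsum : ∑ k, coordFun N k p ^ 2 = shiftedSq N ε p - ε ^ 2 := by
    rw [sum_coordFun_sq, shiftedSq]; ring
  have e : shiftedSq N ε p ^ (-(N : ℝ) / 2 - 1)
      = shiftedSq N ε p ^ (-((N : ℝ) + 4) / 2) * shiftedSq N ε p := by
    rw [← rpow_add_one hQ.ne']; congr 1; ring
  have e' : -(N : ℝ) / 2 - 2 = -((N : ℝ) + 4) / 2 := by ring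
  simp only [coordLaplacian, dirDeriv₂_shiftedSq_rpow hε, Finset.sum_add_distrib,
    ← Finset.sum_mul, ← Finset.mul_sum, hsum, e, e']
  simp
  ring

theorem shiftedSq_rpow_le_inv_norm_pow {N : ℕ} (ε : ℝ) {p : DoubledSpace N} (hp : p ≠ 0) :
    shiftedSq N ε p ^ (-(N : ℝ) / 2) ≤ (‖p‖ ^ N)⁻¹ := by
  have hp' : 0 < ‖p‖ := norm_pos_iff.mpr hp
  have h1 := norm_sq_le_shiftedSq ε p
  have hN : (0 : ℝ) ≤ N := N.cast_nonneg
  calc shiftedSq N ε p ^ (-(N : ℝ) / 2) ≤ (‖p‖ ^ 2) ^ (-(N : ℝ) / 2) :=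
        rpow_le_rpow_of_nonpos (by positivity) (by nlinarith [sq_nonneg ε]) (by linarith)
    _ = (‖p‖ ^ N)⁻¹ := by
        rw [← rpow_natCast, ← rpow_mul hp'.le, ← rpow_natCast, ← rpow_neg hp'.le]
        congr 1; push_cast; ring

theorem shiftedSq_rpow_nonneg {N : ℕ} (ε s : ℝ) (p : DoubledSpace N) :
    0 ≤ shiftedSq N ε p ^ s := by
  unfold shiftedSq; positivity

theorem measurable_shiftedSq_rpow (N : ℕ) (ε s : ℝ) :
    Measurable (fun p : DoubledSpace N => shiftedSq N ε p ^ s) :=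
  (contDiff_shiftedSq N ε).continuous.measurable.pow_const s

/-- The singular part near the origin of the radial majorant of the kernel. -/
def singularPart (N : ℕ) : DoubledSpace N → ℝ :=
  (ball 0 1).indicator fun p => (‖p‖ ^ N)⁻¹

theorem singularPart_nonneg {N : ℕ} (p : DoubledSpace N) : 0 ≤ singularPart N p :=
  indicator_nonneg (fun _ _ => by positivity) p

theorem integrable_singularPart (N : ℕ) : Integrable (singularPart N) := by
  rw [singularPart, integrable_indicator_iff measurableSet_ball,
    integrableOn_fun_norm_addHaar volume (f := fun r => (r ^ N)⁻¹), finrank_doubledSpace]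
  have h : IntegrableOn (fun y : ℝ => y) (Ioo 0 1) :=
    (continuous_id.integrableOn_Icc (a := 0) (b := 1)).mono_set Ioo_subset_Icc_self
  refine h.congr_fun (fun y hy => ?_) measurableSet_Ioo
  have hy0 : y ≠ 0 := hy.1.ne'
  simp only [smul_eq_mul, show N + 2 - 1 = N + 1 by omega, pow_succ]
  field_simp

theorem inv_norm_pow_le {N : ℕ} (p : DoubledSpace N) :
    (‖p‖ ^ N)⁻¹ ≤ singularPart N p + 1 := by
  by_cases h : p ∈ ball (0 : DoubledSpace N) 1
  · rw [singularPart, indicator_of_mem h]; linarith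
  · have h1 : 1 ≤ ‖p‖ := by simpa using h
    rw [singularPart, indicator_of_notMem h, zero_add]
    exact inv_le_one_of_one_le₀ (one_le_pow₀ h1)

/-- The approximate identity behind the fundamental solution. -/
theorem tendsto_integral_approx {N : ℕ} {g : DoubledSpace N → ℝ} (hg : Continuous g)
    (hgc : HasCompactSupport g) :
    Tendsto (fun ε : ℝ => ε ^ 2 * ∫ p, shiftedSq N ε p ^ (-((N : ℝ) + 4) / 2) * g p) (𝓝[>] 0)
      (𝓝 ((∫ p, shiftedSq N 1 p ^ (-((N : ℝ) + 4) / 2)) * g 0)) := by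
  obtain ⟨M, hM⟩ := hg.bounded_above_of_compact_support hgc
  have hlim : Tendsto (fun ε : ℝ => ∫ p, shiftedSq N 1 p ^ (-((N : ℝ) + 4) / 2) * g (ε • p))
      (𝓝[>] 0) (𝓝 (∫ p, shiftedSq N 1 p ^ (-((N : ℝ) + 4) / 2) * g 0)) := by
    refine tendsto_integral_filter_of_dominated_convergence
      (fun p => shiftedSq N 1 p ^ (-((N : ℝ) + 4) / 2) * M) ?_ ?_
      ((integrable_shiftedSq_one_rpow N).mul_const M) ?_
    · refine Eventually.of_forall fun ε => ?_
      exact ((measurable_shiftedSq_rpow N 1 _).mul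
        (hg.comp (continuous_const_smul ε)).measurable).aestronglyMeasurable
    · refine Eventually.of_forall fun ε => ae_of_all _ fun p => ?_
      rw [norm_mul, Real.norm_of_nonneg (shiftedSq_rpow_nonneg _ _ _)]
      exact mul_le_mul_of_nonneg_left (hM _) (shiftedSq_rpow_nonneg _ _ _)
    · refine ae_of_all _ fun p => Tendsto.const_mul _ ?_
      have : Tendsto (fun ε : ℝ => g (ε • p)) (𝓝 0) (𝓝 (g ((0 : ℝ) • p))) :=
        (hg.comp (continuous_id.smul continuous_const)).tendsto 0
      rw [zero_smul] at this
      exact this.mono_left nhdsWithin_le_nhds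
  rw [integral_mul_const] at hlim
  refine hlim.congr' ?_
  filter_upwards [self_mem_nhdsWithin] with ε hε
  have hε : 0 < ε := hε
  have hscale : ∀ w : DoubledSpace N, shiftedSq N ε (ε • w) ^ (-((N : ℝ) + 4) / 2)
      = (ε ^ (N + 4))⁻¹ * shiftedSq N 1 w ^ (-((N : ℝ) + 4) / 2) := fun w => by
    have h1 : shiftedSq N ε (ε • w) = ε ^ 2 * shiftedSq N 1 w := by
      simp only [shiftedSq, Prod.smul_fst, Prod.smul_snd, norm_smul, mul_pow, norm_eq_abs, sq_abs]
      ring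
    rw [h1, mul_rpow (by positivity) (shiftedSq_pos one_ne_zero w).le]
    congr 1
    rw [← rpow_natCast, ← rpow_mul hε.le, ← rpow_natCast, ← rpow_neg hε.le]
    congr 1; push_cast; ring
  have h2 := Measure.integral_comp_smul_of_nonneg (volume : Measure (DoubledSpace N))
    (fun p => shiftedSq N ε p ^ (-((N : ℝ) + 4) / 2) * g p) ε (hR := hε.le)
  simp only [hscale, mul_assoc, finrank_doubledSpace, smul_eq_mul] at h2
  rw [integral_const_mul] at h2
  have h3 : ε ^ (N + 4) = ε ^ (N + 2) * ε ^ 2 := by ring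
  rw [h3] at h2
  field_simp at h2
  simp only [neg_div]
  exact h2

theorem integrable_singularPart_mul {N : ℕ} {g : DoubledSpace N → ℝ} (hg : Continuous g)
    (hgc : HasCompactSupport g) : Integrable (fun p => (singularPart N p + 1) * ‖g p‖) := by
  obtain ⟨M, hM⟩ := hg.bounded_above_of_compact_support hgc
  simp only [add_mul, one_mul]
  refine Integrable.add ?_ (hg.integrable_of_hasCompactSupport hgc).norm
  exact (integrable_singularPart N).mul_bdd (c := M) hg.norm.aestronglyMeasurable
    (ae_of_all _ fun p => by simpa using hM p)

theorem tendsto_integral_kernel {N : ℕ} {g : DoubledSpace N → ℝ} (hg : Continuous g)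
    (hgc : HasCompactSupport g) :
    Tendsto (fun ε : ℝ => ∫ p, shiftedSq N ε p ^ (-(N : ℝ) / 2) * g p) (𝓝[>] 0)
      (𝓝 (∫ p, shiftedSq N 0 p ^ (-(N : ℝ) / 2) * g p)) := by
  have hne : (𝓝[≠] (0 : DoubledSpace N)).NeBot := Module.punctured_nhds_neBot ℝ _ 0
  have hae : ∀ᵐ p : DoubledSpace N, p ≠ 0 := Measure.ae_ne volume 0
  refine tendsto_integral_filter_of_dominated_convergence
    (fun p => (singularPart N p + 1) * ‖g p‖) ?_ ?_ (integrable_singularPart_mul hg hgc) ?_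
  · exact Eventually.of_forall fun ε =>
      ((measurable_shiftedSq_rpow N ε _).mul hg.measurable).aestronglyMeasurable
  · refine Eventually.of_forall fun ε => hae.mono fun p hp => ?_
    rw [norm_mul, Real.norm_of_nonneg (shiftedSq_rpow_nonneg _ _ _)]
    gcongr
    exact (shiftedSq_rpow_le_inv_norm_pow ε hp).trans (inv_norm_pow_le p)
  · refine hae.mono fun p hp => Tendsto.mul_const _ ?_
    have hpos : 0 < shiftedSq N 0 p := by
      have := norm_sq_le_shiftedSq 0 p
      have := norm_pos_iff.mpr hp
      nlinarith
    have hc : Continuous fun ε : ℝ => shiftedSq N ε p := by unfold shiftedSq; fun_prop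
    exact ((hc.tendsto 0).rpow_const (Or.inl hpos.ne')).mono_left nhdsWithin_le_nhds

/-- The kernel `(‖x‖² + ‖y‖²)^(-N/2)` is a multiple of the fundamental solution of the
Laplacian on `ℝ^N × ℝ²`. -/
theorem integral_kernel_mul_coordLaplacian {N : ℕ} (hN : 1 ≤ N) {g : DoubledSpace N → ℝ}
    (hg : ContDiff ℝ (⊤ : ℕ∞) g) (hgc : HasCompactSupport g) :
    ∫ p, shiftedSq N 0 p ^ (-(N : ℝ) / 2) * coordLaplacian g p = -(4 * π / cN N) * g 0 := by
  refine tendsto_nhds_unique (tendsto_integral_kernel (continuous_coordLaplacian hg)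
    (hasCompactSupport_coordLaplacian hgc)) ?_
  have h := (tendsto_integral_approx hg.continuous hgc).const_mul (-((N : ℝ) * (N + 2)))
  rw [← mul_assoc, neg_mul, integral_shiftedSq_one_rpow hN] at h
  refine h.congr' ?_
  filter_upwards [self_mem_nhdsWithin] with ε hε
  have hε : 0 < ε := hε
  rw [integral_mul_coordLaplacian (contDiff_shiftedSq_rpow N hε.ne' _) hg hgc]
  simp only [coordLaplacian_shiftedSq_rpow hε.ne', mul_assoc, integral_const_mul]

theorem coordLaplacian_comp_add {N : ℕ} (f : DoubledSpace N → ℝ) (a p : DoubledSpace N) :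
    coordLaplacian (fun q => f (q + a)) p = coordLaplacian f (p + a) := by
  simp only [coordLaplacian, dirDeriv₂, fderiv_comp_add_right]
  refine Finset.sum_congr rfl fun k _ => ?_
  rw [fderiv_comp_add_right (f := fun q => fderiv ℝ f q (coordDir N k))]

theorem integral_translated_kernel_mul_coordLaplacian {N : ℕ} (hN : 1 ≤ N)
    {g : DoubledSpace N → ℝ} (hg : ContDiff ℝ (⊤ : ℕ∞) g) (hgc : HasCompactSupport g)
    (a : DoubledSpace N) :
    ∫ p, shiftedSq N 0 (p - a) ^ (-(N : ℝ) / 2) * coordLaplacian g p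
      = -(4 * π / cN N) * g a := by
  have h := integral_kernel_mul_coordLaplacian hN (g := fun q => g (q + a))
    (hg.comp (contDiff_id.add contDiff_const)) (hgc.comp_homeomorph (Homeomorph.addRight a))
  simp only [coordLaplacian_comp_add, zero_add] at h
  rw [← h, ← integral_sub_right_eq_self
    (fun q => shiftedSq N 0 q ^ (-(N : ℝ) / 2) * coordLaplacian g (q + a)) a]
  simp

/-- The translated kernel, tested on a bounded set, decays like `(1 + ‖y‖)^(-N)` up to an
integrable singularity. -/
theorem kernel_le_decay {N : ℕ} (hN : 1 ≤ N) {R : ℝ} {p : DoubledSpace N} (hp : ‖p‖ ≤ R)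
    (y : EuclideanSpace ℝ (Fin N)) :
    shiftedSq N 0 (p - (y, 0)) ^ (-(N : ℝ) / 2)
      ≤ (2 * (1 + R)) ^ N * ((1 + ‖y‖) ^ (-(N : ℝ)) * (singularPart N (p - (y, 0)) + 1)) := by
  have hR : 0 ≤ R := (norm_nonneg p).trans hp
  have hy : ‖y‖ ≤ R + ‖p - (y, 0)‖ := by
    have h1 : ‖y‖ = ‖((y, 0) : DoubledSpace N)‖ := by simp [Prod.norm_def]
    have h2 : ((y, 0) : DoubledSpace N) = p - (p - (y, 0)) := by abel
    calc ‖y‖ = ‖p - (p - (y, 0))‖ := by rw [← h2, h1]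
      _ ≤ ‖p‖ + ‖p - (y, 0)‖ := norm_sub_le _ _
      _ ≤ _ := by gcongr
  generalize p - (y, 0) = q at hy ⊢
  have hK : shiftedSq N 0 q ^ (-(N : ℝ) / 2) ≤ (‖q‖ ^ N)⁻¹ := by
    rcases eq_or_ne q 0 with rfl | hq
    · have : -(N : ℝ) / 2 ≠ 0 := by
        have : (0 : ℝ) < N := by exact_mod_cast hN
        exact (by linarith : -(N : ℝ) / 2 < 0).ne
      simp [shiftedSq, zero_rpow this]
    · exact shiftedSq_rpow_le_inv_norm_pow 0 hq
  have hG := singularPart_nonneg q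
  have h2 : (1 + ‖q‖) ^ N * (‖q‖ ^ N)⁻¹ ≤ 2 ^ N * (singularPart N q + 1) := by
    rcases le_or_gt 1 ‖q‖ with h | h
    · have h3 : (1 + ‖q‖) ^ N * (‖q‖ ^ N)⁻¹ ≤ 2 ^ N := by
        rw [← div_eq_mul_inv, div_le_iff₀ (by positivity), ← mul_pow]
        gcongr
        linarith
      nlinarith [pow_pos (two_pos (α := ℝ)) N]
    · rw [singularPart, indicator_of_mem (by simpa using h)]
      have h3 : (1 + ‖q‖) ^ N ≤ 2 ^ N := by gcongr; linarith
      have h4 : 0 ≤ (‖q‖ ^ N)⁻¹ := by positivity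
      nlinarith [pow_pos (two_pos (α := ℝ)) N]
  have h3 : (1 + ‖y‖) ^ N ≤ (1 + R) ^ N * (1 + ‖q‖) ^ N := by
    rw [← mul_pow]
    gcongr
    nlinarith [norm_nonneg q]
  rw [rpow_neg (by positivity), rpow_natCast, mul_left_comm, ← div_eq_inv_mul,
    le_div_iff₀ (by positivity)]
  calc shiftedSq N 0 q ^ (-(N : ℝ) / 2) * (1 + ‖y‖) ^ N
      ≤ (‖q‖ ^ N)⁻¹ * ((1 + R) ^ N * (1 + ‖q‖) ^ N) := by gcongr
    _ = (1 + R) ^ N * ((1 + ‖q‖) ^ N * (‖q‖ ^ N)⁻¹) := by ring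
    _ ≤ (1 + R) ^ N * (2 ^ N * (singularPart N q + 1)) := by gcongr
    _ = (2 * (1 + R)) ^ N * (singularPart N q + 1) := by rw [mul_pow]; ring

theorem measurePreserving_shear (N : ℕ) :
    MeasurePreserving (fun z : EuclideanSpace ℝ (Fin N) × DoubledSpace N =>
      (z.1, z.2 - (z.1, 0))) := by
  refine (MeasurePreserving.id volume).skew_product
    (g := fun (y : EuclideanSpace ℝ (Fin N)) (p : DoubledSpace N) => p - (y, 0)) ?_ ?_
  · exact Continuous.measurable (by unfold Function.uncurry; fun_prop)
  · exact ae_of_all _ fun y => (measurePreserving_sub_right volume _).map_eq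

theorem integrable_mul_singularPart_sub {N : ℕ} {h : EuclideanSpace ℝ (Fin N) → ℝ}
    (hh : Integrable h) :
    Integrable (fun z : DoubledSpace N × EuclideanSpace ℝ (Fin N) =>
      h z.2 * singularPart N (z.1 - (z.2, 0))) :=
  ((measurePreserving_shear N).integrable_comp_of_integrable
    (hh.mul_prod (integrable_singularPart N))).swap

theorem integrable_kernel_mul {N : ℕ} (hN : 1 ≤ N) {u : EuclideanSpace ℝ (Fin N) → ℝ}
    (hu : MemL10 N u) {g : DoubledSpace N → ℝ} (hg : Continuous g) (hgc : HasCompactSupport g) :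
    Integrable (fun z : DoubledSpace N × EuclideanSpace ℝ (Fin N) =>
      u z.2 * shiftedSq N 0 (z.1 - (z.2, 0)) ^ (-(N : ℝ) / 2) * g z.1) := by
  obtain ⟨M, hM⟩ := hg.bounded_above_of_compact_support hgc
  obtain ⟨R, hR⟩ := hgc.isBounded.exists_norm_le
  have hmaj : Integrable (fun z : DoubledSpace N × EuclideanSpace ℝ (Fin N) =>
      (2 * (1 + R)) ^ N * (((1 + ‖z.2‖) ^ (-(N : ℝ)) * |u z.2|)
        * singularPart N (z.1 - (z.2, 0)) * ‖g z.1‖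
        + ‖g z.1‖ * ((1 + ‖z.2‖) ^ (-(N : ℝ)) * |u z.2|))) := by
    refine Integrable.const_mul (Integrable.add ?_ ?_) _
    · refine (integrable_mul_singularPart_sub hu.2).mul_bdd (c := M)
        (hg.comp continuous_fst).norm.aestronglyMeasurable (ae_of_all _ fun z => ?_)
      simpa using hM z.1
    · exact (hg.integrable_of_hasCompactSupport hgc).norm.mul_prod hu.2
  refine hmaj.mono' ?_ (ae_of_all _ fun z => ?_)
  · have hk : Measurable (fun z : DoubledSpace N × EuclideanSpace ℝ (Fin N) =>
        shiftedSq N 0 (z.1 - (z.2, 0)) ^ (-(N : ℝ) / 2)) :=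
      (measurable_shiftedSq_rpow N 0 _).comp (Continuous.measurable (by fun_prop))
    exact (hu.1.aestronglyMeasurable.comp_snd.mul hk.aestronglyMeasurable).mul
      (hg.comp continuous_fst).aestronglyMeasurable
  · by_cases hz : z.1 ∈ tsupport g
    · have hk := kernel_le_decay hN (hR z.1 hz) z.2
      rw [norm_mul, norm_mul, Real.norm_of_nonneg (shiftedSq_rpow_nonneg _ _ _), norm_eq_abs (u z.2)]
      calc _ ≤ |u z.2| * ((2 * (1 + R)) ^ N * ((1 + ‖z.2‖) ^ (-(N : ℝ))
            * (singularPart N (z.1 - (z.2, 0)) + 1))) * ‖g z.1‖ := by gcongr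
        _ = _ := by ring
    · simp [image_eq_zero_of_notMem_tsupport hz]

/-- the doubled extension `W_u(x,y) = w_u(x,|y|)` satisfies
`−Δ W_u = 2π u ℒ^N ⊗ δ_{(0,0)}` in `ℝ^{N+2}` in the distributional sense:
for every `Φ ∈ C_c^∞(ℝ^{N+2})`,
`∫ W_u ΔΦ dx dy = −2π ∫ u(x) Φ(x,0) dx`. -/
theorem stmt7 (N : ℕ) (hN : 1 ≤ N) (u : EuclideanSpace ℝ (Fin N) → ℝ)
    (hu : MemL10 N u)
    (Φ : EuclideanSpace ℝ (Fin N) × EuclideanSpace ℝ (Fin 2) → ℝ)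
    (hΦ : ContDiff ℝ (⊤ : ℕ∞) Φ) (hΦc : HasCompactSupport Φ) :
    (∫ p : EuclideanSpace ℝ (Fin N) × EuclideanSpace ℝ (Fin 2),
        poissonExt N u p.1 ‖p.2‖ *
          ((∑ i : Fin N, iteratedDeriv 2
              (fun s : ℝ => Φ (p.1 + s • EuclideanSpace.single i (1 : ℝ), p.2)) 0)
            + (∑ j : Fin 2, iteratedDeriv 2
              (fun s : ℝ => Φ (p.1, p.2 + s • EuclideanSpace.single j (1 : ℝ))) 0)))
      = -(2 * Real.pi) * ∫ x, u x * Φ (x, 0) := by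
  have hc : cN N ≠ 0 := by
    have hN' : (0 : ℝ) < N := by exact_mod_cast hN
    exact (div_pos (Real.Gamma_pos_of_pos (by positivity)) (by positivity)).ne'
  have hlap : ∀ p : DoubledSpace N,
      ((∑ i : Fin N, iteratedDeriv 2
          (fun s : ℝ => Φ (p.1 + s • EuclideanSpace.single i (1 : ℝ), p.2)) 0)
        + (∑ j : Fin 2, iteratedDeriv 2
          (fun s : ℝ => Φ (p.1, p.2 + s • EuclideanSpace.single j (1 : ℝ))) 0))
        = coordLaplacian Φ p := fun p => by
    simp only [coordLaplacian, Fintype.sum_sum_type, ← iteratedDeriv_two_line hΦ]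
    congr 1 <;> refine Finset.sum_congr rfl fun k _ => ?_ <;> congr 1 <;> ext s <;>
      congr 1 <;> ext <;> simp [coordDir]
  have hW : ∀ p : DoubledSpace N, poissonExt N u p.1 ‖p.2‖ * coordLaplacian Φ p
      = cN N / 2 * ∫ y, u y * shiftedSq N 0 (p - (y, 0)) ^ (-(N : ℝ) / 2)
          * coordLaplacian Φ p := fun p => by
    rw [integral_mul_const, ← mul_assoc]
    simp [poissonExt, shiftedSq]
  rw [integral_congr_ae (ae_of_all _ fun p => (congrArg _ (hlap p)).trans (hW p)),
    integral_const_mul, integral_integral_swap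
    (integrable_kernel_mul hN hu (continuous_coordLaplacian hΦ)
      (hasCompactSupport_coordLaplacian hΦc))]
  simp_rw [mul_assoc, integral_const_mul,
    integral_translated_kernel_mul_coordLaplacian hN hΦ hΦc]
  rw [← integral_const_mul, ← integral_const_mul]
  congr 1; ext y
  field_simp
  ring
end
end

section
/- Let N ≥ 1 and d = N + 2, and let W : ℝ^d = ℝ^N × ℝ² → ℝ be a harmonic function (ΔW = 0 on all of ℝ^d) such that there exist constants C, σ > 0 with ∫_{B_1(X)} |W| ≤ C (1+|X|)^σ for every X ∈ ℝ^d, and such that for every x ∈ ℝ^N one has W(x,y) → 0 as |y| → ∞ (y ∈ ℝ²). Then W ≡ 0 on ℝ^d. -/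
open MeasureTheory Real Filter Topology Set Metric

noncomputable section

section HarmonicLiouville

variable {E : Type*} [NormedAddCommGroup E] [NormedSpace ℝ E] {ι : Type*} [Fintype ι]

/-- The Euclidean square norm attached to a basis. -/
def coordSq (b : Module.Basis ι ℝ E) (z : E) : ℝ := ∑ k, b.repr z k ^ 2

/-- A radial, compactly supported, Lipschitz weight for the Euclidean structure of a basis. -/
def cutoff (b : Module.Basis ι ℝ E) (z : E) : ℝ := max 0 (1 - coordSq b z)

/-- The Laplacian, computed in the coordinates of a basis, vanishes everywhere. -/
def LaplaceZero (b : Module.Basis ι ℝ E) (W : E → ℝ) : Prop :=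
  ∀ p, ∑ k, iteratedDeriv 2 (fun s : ℝ => W (p + s • b k)) 0 = 0

theorem hasDerivAt_max_zero_sq (x : ℝ) :
    HasDerivAt (fun t : ℝ => max 0 t ^ 2) (2 * max 0 x) x := by
  rcases lt_trichotomy x 0 with h | h | h
  · rw [max_eq_left h.le, mul_zero]
    refine (hasDerivAt_const x (0 : ℝ)).congr_of_eventuallyEq ?_
    filter_upwards [Iio_mem_nhds h] with t ht
    rw [max_eq_left (le_of_lt ht)]; norm_num
  · subst h
    have : HasFDerivAt (fun t : ℝ => max 0 t ^ 2) (0 : ℝ →L[ℝ] ℝ) 0 := by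
      refine Asymptotics.IsBigO.hasFDerivAt (n := 2) ?_ one_lt_two
      refine Asymptotics.IsBigO.of_bound 1 (Eventually.of_forall fun t => ?_)
      rcases le_total 0 t with ht | ht
      · simp [max_eq_right ht]
      · simp [max_eq_left ht]; positivity
    simpa using this.hasDerivAt
  · rw [max_eq_right h.le]
    refine (by simpa using hasDerivAt_pow 2 x : HasDerivAt (fun t : ℝ => t ^ 2) (2 * x) x)
      |>.congr_of_eventuallyEq ?_
    filter_upwards [Ioi_mem_nhds h] with t ht
    rw [max_eq_right (le_of_lt ht)]

theorem cutoff_nonneg (b : Module.Basis ι ℝ E) (z : E) : 0 ≤ cutoff b z := le_max_left _ _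

theorem cutoff_le_one (b : Module.Basis ι ℝ E) (z : E) : cutoff b z ≤ 1 := by
  have : 0 ≤ coordSq b z := Finset.sum_nonneg fun k _ => sq_nonneg _
  exact max_le zero_le_one (by linarith)

theorem abs_repr_lt_one {b : Module.Basis ι ℝ E} {z : E} (hz : coordSq b z < 1) (k : ι) :
    |b.repr z k| < 1 := by
  have h : b.repr z k ^ 2 ≤ coordSq b z :=
    Finset.single_le_sum (f := fun k => b.repr z k ^ 2) (fun k _ => sq_nonneg _)
      (Finset.mem_univ k)
  exact (sq_lt_one_iff_abs_lt_one _).1 (h.trans_lt hz)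

theorem norm_le_of_coordSq_lt_one {b : Module.Basis ι ℝ E} {z : E} (hz : coordSq b z < 1) :
    ‖z‖ ≤ ∑ k, ‖b k‖ := by
  conv_lhs => rw [← b.sum_repr z]
  refine (norm_sum_le _ _).trans (Finset.sum_le_sum fun k _ => ?_)
  rw [norm_smul, Real.norm_eq_abs]
  exact mul_le_of_le_one_left (norm_nonneg _) (abs_repr_lt_one hz k).le

theorem cutoff_eq_zero {b : Module.Basis ι ℝ E} {z : E} (hz : ∑ k, ‖b k‖ < ‖z‖) :
    cutoff b z = 0 := by
  refine max_eq_left ?_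
  by_contra! h
  exact absurd (norm_le_of_coordSq_lt_one (b := b) (z := z) (by linarith)) (not_le.2 hz)

theorem coordSq_lt_one_of_cutoff_ne_zero {b : Module.Basis ι ℝ E} {z : E}
    (hz : cutoff b z ≠ 0) : coordSq b z < 1 := by
  by_contra! h
  exact hz (max_eq_left (by linarith))

/-- A translation by `s • b k`, `0 ≤ s ≤ 1`, changes the weight by at most `5 * s`. -/
theorem abs_cutoff_sub_le (b : Module.Basis ι ℝ E) (k : ι) {s : ℝ} (hs : 0 ≤ s) (hs1 : s ≤ 1)
    (z : E) : |cutoff b (z - s • b k) - cutoff b z| ≤ 5 * s := by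
  classical
  have hq : coordSq b (z - s • b k) - coordSq b z = -2 * s * b.repr z k + s ^ 2 := by
    rw [coordSq, coordSq, ← Finset.sum_sub_distrib, Finset.sum_eq_single k]
    · simp; ring
    · intro j _ hj
      simp [hj.symm]
    · simp
  have hk : cutoff b (z - s • b k) ≠ 0 ∨ cutoff b z ≠ 0 → |b.repr z k| ≤ 2 := by
    rintro (h | h)
    · have := abs_repr_lt_one (coordSq_lt_one_of_cutoff_ne_zero h) k
      simp only [map_sub, map_smul, Module.Basis.repr_self, Finsupp.coe_sub, Pi.sub_apply,
        Finsupp.coe_smul, Pi.smul_apply, Finsupp.single_eq_same, smul_eq_mul, mul_one] at this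
      rw [abs_lt] at this
      rw [abs_le]
      constructor <;> linarith
    · linarith [abs_repr_lt_one (coordSq_lt_one_of_cutoff_ne_zero h) k]
  by_cases h : cutoff b (z - s • b k) ≠ 0 ∨ cutoff b z ≠ 0
  · have h2 := abs_le.1 (hk h)
    have h3 : |cutoff b (z - s • b k) - cutoff b z|
        ≤ |coordSq b (z - s • b k) - coordSq b z| := by
      refine (abs_max_sub_max_le_max _ _ _ _).trans (max_le (by simp) ?_)
      rw [abs_sub_comm]
      exact le_of_eq (by congr 1; ring)
    refine h3.trans ?_
    rw [hq, abs_le]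
    constructor <;> nlinarith
  · push Not at h
    rw [h.1, h.2]
    simpa using hs

theorem LaplaceZero.sum_fderiv_fderiv {b : Module.Basis ι ℝ E} {W : E → ℝ}
    (hW : ContDiff ℝ 2 W) (h : LaplaceZero b W) (p : E) :
    ∑ k, fderiv ℝ (fun q => fderiv ℝ W q (b k)) p (b k) = 0 := by
  rw [← h p]
  refine Finset.sum_congr rfl fun k _ => ?_
  have hl : ∀ s : ℝ, HasDerivAt (fun s : ℝ => p + s • b k) (b k) s := fun s => by
    simpa using ((hasDerivAt_id s).smul_const (b k)).const_add p
  have h1 : deriv (fun s : ℝ => W (p + s • b k)) = fun s => fderiv ℝ W (p + s • b k) (b k) := by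
    funext s
    exact (((hW.differentiable (by norm_num)) _).hasFDerivAt.comp_hasDerivAt s (hl s)).deriv
  have h2 : Differentiable ℝ (fun q => fderiv ℝ W q (b k)) :=
    ((hW.fderiv_right (m := 1) (by norm_num)).clm_apply contDiff_const).differentiable (by norm_num)
  rw [iteratedDeriv_succ, iteratedDeriv_one, h1]
  have h3 := ((h2 (p + (0 : ℝ) • b k)).hasFDerivAt.comp_hasDerivAt 0 (hl 0)).deriv
  simp only [zero_smul, add_zero] at h3
  exact h3.symm

theorem LaplaceZero.translate_sub {b : Module.Basis ι ℝ E} {W : E → ℝ}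
    (hW : ContDiff ℝ 2 W) (h : LaplaceZero b W) (e : E) :
    LaplaceZero b (fun p => W (p + e) - W p) := by
  intro p
  have hc : ∀ q k, ContDiffAt ℝ ((2 : ℕ) : WithTop ℕ∞) (fun s : ℝ => W (q + s • b k)) 0 :=
    fun q k => (hW.comp (by fun_prop)).contDiffAt
  have := congrArg₂ (· - ·) (h (p + e)) (h p)
  simp only [← Finset.sum_sub_distrib, sub_zero] at this
  refine Eq.trans (Finset.sum_congr rfl fun k _ => ?_) this
  rw [← iteratedDeriv_fun_sub (hc (p + e) k) (hc p k)]
  simp only [add_right_comm p e]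

variable [FiniteDimensional ℝ E]

theorem continuous_coordSq (b : Module.Basis ι ℝ E) : Continuous (coordSq b) :=
  continuous_finsetSum _ fun k _ => ((b.coord k).continuous_of_finiteDimensional).pow 2

theorem continuous_cutoff (b : Module.Basis ι ℝ E) : Continuous (cutoff b) :=
  continuous_const.max (continuous_const.sub (continuous_coordSq b))

theorem hasCompactSupport_cutoff (b : Module.Basis ι ℝ E) : HasCompactSupport (cutoff b) := by
  refine HasCompactSupport.intro (isCompact_closedBall (0 : E) (∑ k, ‖b k‖)) fun z hz => ?_
  exact cutoff_eq_zero (by simpa using hz)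

/-- A primitive of the radial field `z ↦ cutoff b z • z`. -/
theorem hasFDerivAt_cutoff_sq (b : Module.Basis ι ℝ E) (z : E) :
    HasFDerivAt (fun z => -(1 / 4) * cutoff b z ^ 2)
      (cutoff b z • ∑ k, b.repr z k • (b.coord k).toContinuousLinearMap) z := by
  have h1 : HasFDerivAt (fun z => 1 - coordSq b z)
      (-∑ k, (2 * b.repr z k) • (b.coord k).toContinuousLinearMap) z := by
    refine HasFDerivAt.const_sub ?_ 1
    refine HasFDerivAt.fun_sum fun k _ => ?_
    have hk : HasFDerivAt (fun z => b.repr z k) (b.coord k).toContinuousLinearMap z :=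
      (b.coord k).toContinuousLinearMap.hasFDerivAt
    simpa using hk.pow 2
  have h2 := ((hasDerivAt_max_zero_sq (1 - coordSq b z)).comp_hasFDerivAt z h1).const_mul (-(1 / 4))
  refine h2.congr_fderiv ?_
  simp only [mul_smul, ← Finset.smul_sum, cutoff]
  module

theorem fderiv_cutoff_sq_apply (b : Module.Basis ι ℝ E) (z : E) (k : ι) :
    fderiv ℝ (fun z => -(1 / 4) * cutoff b z ^ 2) z (b k) = b.repr z k * cutoff b z := by
  classical
  rw [(hasFDerivAt_cutoff_sq b z).fderiv]
  simp [Finsupp.single_apply, mul_comm]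

variable [MeasurableSpace E] [BorelSpace E] (μ : Measure E) [μ.IsAddHaarMeasure]

theorem integral_cutoff_pos (b : Module.Basis ι ℝ E) : 0 < ∫ z, cutoff b z ∂μ :=
  (continuous_cutoff b).integral_pos_of_hasCompactSupport_nonneg_nonzero (x := 0)
    (hasCompactSupport_cutoff b) (cutoff_nonneg b) (by simp [cutoff, coordSq])

theorem integrable_mul_cutoff (b : Module.Basis ι ℝ E) {f : E → ℝ} (hf : Continuous f) :
    Integrable (fun z => f z * cutoff b z) μ :=
  (hf.mul (continuous_cutoff b)).integrable_of_hasCompactSupport (hasCompactSupport_cutoff b).mul_left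

/-- The radial derivative of a harmonic function has weighted mean zero. -/
theorem LaplaceZero.integral_radial_eq_zero {b : Module.Basis ι ℝ E} {W : E → ℝ}
    (hW : ContDiff ℝ 2 W) (h : LaplaceZero b W) (X : E) (r : ℝ) :
    ∫ z, fderiv ℝ W (X + r • z) z * cutoff b z ∂μ = 0 := by
  have hD : ∀ k, ContDiff ℝ 1 (fun q => fderiv ℝ W q (b k)) := fun k =>
    (hW.fderiv_right (m := 1) (by norm_num)).clm_apply contDiff_const
  have hDr : ∀ k, ContDiff ℝ 1 (fun z => fderiv ℝ W (X + r • z) (b k)) := fun k =>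
    (hD k).comp (by fun_prop)
  have hrepr : ∀ k, Continuous fun z => b.repr z k := fun k =>
    (b.coord k).continuous_of_finiteDimensional
  have hder : ∀ k z, fderiv ℝ (fun z => fderiv ℝ W (X + r • z) (b k)) z (b k)
      = r * fderiv ℝ (fun q => fderiv ℝ W q (b k)) (X + r • z) (b k) := fun k z => by
    have h1 : HasFDerivAt (fun z : E => X + r • z) (r • ContinuousLinearMap.id ℝ E) z :=
      ((hasFDerivAt_id z).const_smul r).const_add X
    have h2 := ((hD k).differentiable (by norm_num) (X + r • z)).hasFDerivAt.comp z h1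
    have h3 := h2.fderiv
    simp only [Function.comp_def] at h3
    rw [h3]
    simp
  have hparts : ∀ k, ∫ z, fderiv ℝ W (X + r • z) (b k) * (b.repr z k * cutoff b z) ∂μ
      = -∫ z, r * fderiv ℝ (fun q => fderiv ℝ W q (b k)) (X + r • z) (b k) *
          (-(1 / 4) * cutoff b z ^ 2) ∂μ := fun k => by
    have := integral_mul_fderiv_eq_neg_fderiv_mul_of_integrable (μ := μ) (v := b k)
      (f := fun z => fderiv ℝ W (X + r • z) (b k)) (g := fun z => -(1 / 4) * cutoff b z ^ 2)
      ?_ ?_ ?_ (fun x _ => (hDr k).differentiable (by norm_num) x)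
      (fun x _ => (hasFDerivAt_cutoff_sq b x).differentiableAt)
    · simpa only [fderiv_cutoff_sq_apply, hder] using this
    · have hc : Continuous fun z => fderiv ℝ (fun z => fderiv ℝ W (X + r • z) (b k)) z (b k) :=
        ((hDr k).continuous_fderiv (by norm_num)).clm_apply continuous_const
      refine (integrable_mul_cutoff μ b
        (hc.mul ((continuous_cutoff b).const_mul (-(1 / 4))))).congr (Eventually.of_forall fun z => ?_)
      simp only [Pi.mul_apply]; ring
    · simp only [fderiv_cutoff_sq_apply, ← mul_assoc]
      exact integrable_mul_cutoff μ b ((hDr k).continuous.mul (hrepr k))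
    · refine (integrable_mul_cutoff μ b ((hDr k).continuous.mul
        ((continuous_cutoff b).const_mul (-(1 / 4))))).congr (Eventually.of_forall fun z => ?_)
      simp only [Pi.mul_apply]; ring
  have hsum : ∀ z, fderiv ℝ W (X + r • z) z * cutoff b z
      = ∑ k, fderiv ℝ W (X + r • z) (b k) * (b.repr z k * cutoff b z) := fun z => by
    conv_lhs => rw [← b.sum_repr z]
    rw [map_sum, Finset.sum_mul, b.sum_repr z]
    refine Finset.sum_congr rfl fun k _ => ?_
    rw [map_smul, smul_eq_mul]
    ring
  simp only [hsum]
  rw [integral_finsetSum]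
  · simp only [hparts, Finset.sum_neg_distrib]
    rw [← integral_finsetSum]
    · simp only [← Finset.sum_mul, ← Finset.mul_sum, h.sum_fderiv_fderiv hW]
      simp
    · intro k _
      have hc : Continuous fun z =>
          fderiv ℝ (fun q => fderiv ℝ W q (b k)) (X + r • z) (b k) :=
        (((hD k).continuous_fderiv (by norm_num)).comp (by fun_prop)).clm_apply continuous_const
      refine (integrable_mul_cutoff μ b ((hc.const_mul r).mul
        ((continuous_cutoff b).const_mul (-(1 / 4))))).congr (Eventually.of_forall fun z => ?_)
      simp only [Pi.mul_apply]; ring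
  · intro k _
    simp only [← mul_assoc]
    exact integrable_mul_cutoff μ b ((hDr k).continuous.mul (hrepr k))

theorem hasDerivAt_integral_mul_cutoff (b : Module.Basis ι ℝ E) {W : E → ℝ}
    (hW : ContDiff ℝ 2 W) (X : E) (r : ℝ) :
    HasDerivAt (fun r : ℝ => ∫ z, W (X + r • z) * cutoff b z ∂μ)
      (∫ z, fderiv ℝ W (X + r • z) z * cutoff b z ∂μ) r := by
  have hDW : Continuous (fderiv ℝ W) := hW.continuous_fderiv (by norm_num)
  have hWc : Continuous W := hW.continuous
  have hcont : Continuous fun x : ℝ × E => fderiv ℝ W (X + x.1 • x.2) x.2 :=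
    (hDW.comp (by fun_prop)).clm_apply continuous_snd
  obtain ⟨B, hB⟩ := ((isCompact_closedBall r 1).prod
    (isCompact_closedBall (0 : E) (∑ k, ‖b k‖))).exists_bound_of_continuousOn hcont.continuousOn
  refine (hasDerivAt_integral_of_dominated_loc_of_deriv_le (s := closedBall r 1)
    (F := fun r z => W (X + r • z) * cutoff b z)
    (F' := fun r z => fderiv ℝ W (X + r • z) z * cutoff b z)
    (bound := fun z => B * cutoff b z) (closedBall_mem_nhds r one_pos)
    (Eventually.of_forall fun t => ?_) ?_ ?_ (Eventually.of_forall fun z t ht => ?_)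
    (integrable_mul_cutoff μ b continuous_const) (Eventually.of_forall fun z t _ => ?_)).2
  · exact (integrable_mul_cutoff μ b (by fun_prop)).aestronglyMeasurable
  · exact integrable_mul_cutoff μ b (by fun_prop)
  · exact (integrable_mul_cutoff μ b
      (hcont.comp (Continuous.prodMk_right r))).aestronglyMeasurable
  · by_cases hz : cutoff b z = 0
    · simp [hz]
    · rw [norm_mul, Real.norm_of_nonneg (cutoff_nonneg b z)]
      refine mul_le_mul_of_nonneg_right (hB (t, z) ⟨ht, ?_⟩) (cutoff_nonneg b z)
      simpa using norm_le_of_coordSq_lt_one (coordSq_lt_one_of_cutoff_ne_zero hz)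
  · have hl : HasDerivAt (fun t : ℝ => X + t • z) z t := by
      simpa using ((hasDerivAt_id t).smul_const z).const_add X
    exact (((hW.differentiable (by norm_num)) _).hasFDerivAt.comp_hasDerivAt t hl).mul_const _

/-- The weighted mean value property. -/
theorem LaplaceZero.mean_value {b : Module.Basis ι ℝ E} {W : E → ℝ}
    (hW : ContDiff ℝ 2 W) (h : LaplaceZero b W) (X : E) (r : ℝ) :
    ∫ z, W (X + r • z) * cutoff b z ∂μ = W X * ∫ z, cutoff b z ∂μ := by
  have hd := hasDerivAt_integral_mul_cutoff μ b hW X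
  have := is_const_of_deriv_eq_zero (fun t => (hd t).differentiableAt)
    (fun t => (hd t).deriv.trans (h.integral_radial_eq_zero μ hW X t)) r 0
  rw [this]
  simp [integral_const_mul]

theorem LaplaceZero.abs_mul_integral_cutoff_le {b : Module.Basis ι ℝ E} {W : E → ℝ}
    (hW : ContDiff ℝ 2 W) (h : LaplaceZero b W) (X : E) :
    |W X| * ∫ z, cutoff b z ∂μ ≤ ∫ p in {p | coordSq b (p - X) < 1}, |W p| ∂μ := by
  have hWc : Continuous W := hW.continuous
  have hopen : IsOpen {p | coordSq b (p - X) < 1} :=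
    isOpen_lt ((continuous_coordSq b).comp (by fun_prop)) continuous_const
  have hsub : {p | coordSq b (p - X) < 1} ⊆ closedBall X (∑ k, ‖b k‖) := fun p hp => by
    rw [mem_closedBall_iff_norm]
    exact norm_le_of_coordSq_lt_one hp
  have hint : IntegrableOn (fun p => |W p|) {p | coordSq b (p - X) < 1} μ :=
    (hWc.abs.continuousOn.integrableOn_compact (isCompact_closedBall X _)).mono_set hsub
  have hmv := h.mean_value μ hW X 1
  have hshift := integral_sub_right_eq_self (μ := μ) (fun z => W (X + z) * cutoff b z) X
  simp only [one_smul] at hmv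
  rw [← abs_of_pos (integral_cutoff_pos μ b), ← abs_mul, ← hmv, ← hshift,
    ← integral_indicator hopen.measurableSet, ← Real.norm_eq_abs]
  refine norm_integral_le_of_norm_le (hint.integrable_indicator hopen.measurableSet)
    (Eventually.of_forall fun p => ?_)
  rw [add_sub_cancel, norm_mul, Real.norm_eq_abs, Real.norm_of_nonneg (cutoff_nonneg b _)]
  by_cases hp : coordSq b (p - X) < 1
  · rw [indicator_of_mem (by exact hp)]
    exact mul_le_of_le_one_right (abs_nonneg _) (cutoff_le_one b _)
  · rw [indicator_of_notMem (by exact hp)]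
    rw [by_contra fun hc => hp (coordSq_lt_one_of_cutoff_ne_zero hc), mul_zero]

theorem LaplaceZero.abs_translate_sub_le {b : Module.Basis ι ℝ E} {W : E → ℝ}
    (hW : ContDiff ℝ 2 W) (h : LaplaceZero b W) (k : ι) {C : ℝ} (hC : 0 ≤ C) {n : ℕ}
    (hg : ∀ X, |W X| ≤ C * (1 + ‖X‖) ^ n) :
    ∃ K, 0 ≤ K ∧ ∀ X R, 1 + ‖X‖ ≤ R → |W (X + b k) - W X| ≤ K * R ^ n / R := by
  have hWc : Continuous W := hW.continuous
  let μ : Measure E := Measure.addHaar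
  set M := ∑ k, ‖b k‖ with hM
  set I := ∫ z, cutoff b z ∂μ with hI
  have hIpos : 0 < I := integral_cutoff_pos μ b
  have hM0 : 0 ≤ M := Finset.sum_nonneg fun k _ => norm_nonneg _
  have hkM : ‖b k‖ ≤ M :=
    Finset.single_le_sum (f := fun k => ‖b k‖) (fun k _ => norm_nonneg _) (Finset.mem_univ k)
  refine ⟨C * (1 + 2 * M) ^ n * 5 * μ.real (closedBall 0 (2 * M)) / I, by positivity,
    fun X R hR => ?_⟩
  have hR1 : 1 ≤ R := le_trans (by linarith [norm_nonneg X]) hR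
  have hR0 : 0 < R := by linarith
  have hRi : R⁻¹ ≤ 1 := inv_le_one_of_one_le₀ hR1
  have hRi0 : 0 ≤ R⁻¹ := by positivity
  have h1 : ∫ z, W (X + R • z) * cutoff b (z - R⁻¹ • b k) ∂μ = W (X + b k) * I := by
    rw [hI, ← h.mean_value μ hW (X + b k) R,
      ← integral_sub_right_eq_self (fun z => W (X + b k + R • z) * cutoff b z) (R⁻¹ • b k)]
    refine integral_congr_ae (Eventually.of_forall fun z => ?_)
    simp only [smul_sub, smul_inv_smul₀ hR0.ne']
    congr 2
    abel
  have hint1 : Integrable (fun z => W (X + R • z) * cutoff b (z - R⁻¹ • b k)) μ := by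
    have := (integrable_mul_cutoff μ b (f := fun z => W (X + R • (z + R⁻¹ • b k)))
      (by fun_prop)).comp_sub_right (R⁻¹ • b k)
    simpa using this
  have hint2 : Integrable (fun z => W (X + R • z) * cutoff b z) μ :=
    integrable_mul_cutoff μ b (by fun_prop)
  have hdiff : (W (X + b k) - W X) * I = ∫ z in closedBall 0 (2 * M),
      W (X + R • z) * (cutoff b (z - R⁻¹ • b k) - cutoff b z) ∂μ := by
    rw [sub_mul, ← h1, ← h.mean_value μ hW X R, ← integral_sub hint1 hint2,
      setIntegral_eq_integral_of_forall_compl_eq_zero]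
    · simp only [mul_sub]
    · intro z hz
      have hz' : 2 * M < ‖z‖ := by simpa using hz
      have hz1 : cutoff b z = 0 := cutoff_eq_zero (by linarith)
      have hz2 : cutoff b (z - R⁻¹ • b k) = 0 := by
        refine cutoff_eq_zero ?_
        have h3 : ‖R⁻¹ • b k‖ ≤ M := by
          rw [norm_smul, Real.norm_of_nonneg hRi0]
          exact (mul_le_of_le_one_left (norm_nonneg _) hRi).trans hkM
        linarith [norm_sub_norm_le z (R⁻¹ • b k)]
      rw [hz1, hz2, sub_self, mul_zero]
  have hbound : |(W (X + b k) - W X) * I|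
      ≤ C * ((1 + 2 * M) * R) ^ n * (5 * R⁻¹) * μ.real (closedBall 0 (2 * M)) := by
    rw [hdiff, ← Real.norm_eq_abs]
    refine norm_setIntegral_le_of_norm_le_const measure_closedBall_lt_top fun z hz => ?_
    have hz' : ‖z‖ ≤ 2 * M := by simpa using hz
    rw [norm_mul, Real.norm_eq_abs, Real.norm_eq_abs]
    refine mul_le_mul ((hg _).trans ?_) (abs_cutoff_sub_le b k hRi0 hRi z) (abs_nonneg _)
      (by positivity)
    gcongr
    have h4 : ‖X + R • z‖ ≤ ‖X‖ + R * ‖z‖ := by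
      refine (norm_add_le _ _).trans ?_
      rw [norm_smul, Real.norm_of_nonneg hR0.le]
    nlinarith
  rw [abs_mul, abs_of_pos hIpos, ← le_div_iff₀ hIpos] at hbound
  refine hbound.trans (le_of_eq ?_)
  rw [mul_pow]
  field_simp

/-- A harmonic function of polynomial growth which decays along translations in a basis direction
vanishes. -/
theorem LaplaceZero.eq_zero_of_growth {b : Module.Basis ι ℝ E} (k : ι) (n : ℕ) :
    ∀ {W : E → ℝ}, ContDiff ℝ 2 W → LaplaceZero b W →
      (∃ C, 0 ≤ C ∧ ∀ X, |W X| ≤ C * (1 + ‖X‖) ^ n) →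
      (∀ p, Tendsto (fun m : ℕ => W (p + (m : ℝ) • b k)) atTop (𝓝 0)) → ∀ p, W p = 0 := by
  have of_periodic : ∀ {W : E → ℝ}, (∀ p, W (p + b k) - W p = 0) →
      (∀ p, Tendsto (fun m : ℕ => W (p + (m : ℝ) • b k)) atTop (𝓝 0)) → ∀ p, W p = 0 := by
    intro W hper hd p
    have hconst : ∀ m : ℕ, W (p + (m : ℝ) • b k) = W p := fun m => by
      induction m with
      | zero => simp
      | succ m ih =>
        rw [← ih, ← sub_eq_zero, ← hper (p + (m : ℝ) • b k)]
        congr 2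
        push_cast
        module
    have := hd p
    simp only [hconst] at this
    exact tendsto_nhds_unique tendsto_const_nhds this
  induction n with
  | zero =>
    rintro W hW h ⟨C, hC, hg⟩ hd
    refine of_periodic (fun p => ?_) hd
    obtain ⟨K, -, hK⟩ := h.abs_translate_sub_le hW k hC hg
    have hlim : Tendsto (fun R : ℝ => K * R ^ 0 / R) atTop (𝓝 0) := by
      simpa using tendsto_const_nhds.div_atTop tendsto_id
    have := ge_of_tendsto hlim ((eventually_ge_atTop (1 + ‖p‖)).mono fun R hR => hK p R hR)
    exact abs_nonpos_iff.1 this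
  | succ n ih =>
    rintro W hW h ⟨C, hC, hg⟩ hd
    refine of_periodic (ih (W := fun p => W (p + b k) - W p) ?_ (h.translate_sub hW (b k)) ?_ ?_) hd
    · exact (hW.comp (by fun_prop)).sub hW
    · obtain ⟨K, hK0, hK⟩ := h.abs_translate_sub_le hW k hC hg
      refine ⟨K, hK0, fun X => (hK X _ le_rfl).trans (le_of_eq ?_)⟩
      have : (1 + ‖X‖) ≠ 0 := by positivity
      rw [pow_succ]
      field_simp
    · intro p
      have := (hd (p + b k)).sub (hd p)
      simpa only [sub_zero, add_right_comm p (b k)] using this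

end HarmonicLiouville

/-- a Liouville-type theorem. If `W : ℝ^N × ℝ² → ℝ` is harmonic
(`C²` with vanishing Laplacian) on all of `ℝ^{N+2}`, has algebraic growth of
`L¹`-averages over unit balls, and satisfies `W(x,y) → 0` as `|y| → ∞` for each
`x ∈ ℝ^N`, then `W ≡ 0`. -/
theorem stmt8 (N : ℕ) (hN : 1 ≤ N)
    (W : EuclideanSpace ℝ (Fin N) × EuclideanSpace ℝ (Fin 2) → ℝ)
    (hC2 : ContDiff ℝ 2 W)
    (hharm : ∀ p : EuclideanSpace ℝ (Fin N) × EuclideanSpace ℝ (Fin 2),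
      (∑ i : Fin N, iteratedDeriv 2
          (fun s : ℝ => W (p.1 + s • EuclideanSpace.single i (1 : ℝ), p.2)) 0)
        + (∑ j : Fin 2, iteratedDeriv 2
          (fun s : ℝ => W (p.1, p.2 + s • EuclideanSpace.single j (1 : ℝ))) 0) = 0)
    (hAG : ∃ C : ℝ, 0 < C ∧ ∃ σ : ℝ, 0 < σ ∧
      ∀ X : EuclideanSpace ℝ (Fin N) × EuclideanSpace ℝ (Fin 2),
        (∫ p in {p : EuclideanSpace ℝ (Fin N) × EuclideanSpace ℝ (Fin 2) |
            ‖p.1 - X.1‖ ^ 2 + ‖p.2 - X.2‖ ^ 2 < 1}, |W p|)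
          ≤ C * (1 + Real.sqrt (‖X.1‖ ^ 2 + ‖X.2‖ ^ 2)) ^ σ)
    (hdecay : ∀ x : EuclideanSpace ℝ (Fin N),
      Tendsto (fun y : EuclideanSpace ℝ (Fin 2) => W (x, y))
        (Filter.comap norm Filter.atTop) (𝓝 0)) :
    ∀ p : EuclideanSpace ℝ (Fin N) × EuclideanSpace ℝ (Fin 2), W p = 0 := by
  obtain ⟨C, hC, σ, hσ, hg⟩ := hAG
  let b : Module.Basis (Fin N ⊕ Fin 2) ℝ (EuclideanSpace ℝ (Fin N) × EuclideanSpace ℝ (Fin 2)) :=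
    (EuclideanSpace.basisFun (Fin N) ℝ).toBasis.prod (EuclideanSpace.basisFun (Fin 2) ℝ).toBasis
  let μ : Measure (EuclideanSpace ℝ (Fin N) × EuclideanSpace ℝ (Fin 2)) := volume
  have hμ : μ.IsAddHaarMeasure := Measure.prod.instIsAddHaarMeasure volume volume
  have hbl : ∀ i, b (Sum.inl i) = (EuclideanSpace.single i (1 : ℝ), 0) := fun i => by
    simp [b, Module.Basis.prod_apply]
  have hbr : ∀ j, b (Sum.inr j) = (0, EuclideanSpace.single j (1 : ℝ)) := fun j => by
    simp [b, Module.Basis.prod_apply]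
  have hq : ∀ z, coordSq b z = ‖z.1‖ ^ 2 + ‖z.2‖ ^ 2 := fun z => by
    simp [coordSq, b, Fintype.sum_sum_type, EuclideanSpace.norm_sq_eq]
  have hL : LaplaceZero b W := fun p => by
    refine Eq.trans ?_ (hharm p)
    rw [Fintype.sum_sum_type]
    simp only [hbl, hbr, Prod.smul_mk, smul_zero, Prod.add_def, add_zero]
  have hI := integral_cutoff_pos μ b
  refine hL.eq_zero_of_growth (Sum.inr 0) ⌈σ⌉₊ hC2
    ⟨C * 2 ^ ⌈σ⌉₊ / ∫ z, cutoff b z ∂μ, by positivity, fun X => ?_⟩ fun p => ?_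
  · have h1 := (hL.abs_mul_integral_cutoff_le μ hC2 X).trans
      (le_of_eq_of_le (by simp only [hq]; rfl) (hg X))
    rw [← le_div_iff₀ hI] at h1
    refine h1.trans ?_
    have hs : √(‖X.1‖ ^ 2 + ‖X.2‖ ^ 2) ≤ 2 * ‖X‖ := by
      refine Real.sqrt_le_iff.2 ⟨by positivity, ?_⟩
      have h2 := pow_le_pow_left₀ (norm_nonneg _) (norm_fst_le X) 2
      have h3 := pow_le_pow_left₀ (norm_nonneg _) (norm_snd_le X) 2
      nlinarith [sq_nonneg ‖X‖]
    have hp : (1 + √(‖X.1‖ ^ 2 + ‖X.2‖ ^ 2)) ^ σ ≤ 2 ^ ⌈σ⌉₊ * (1 + ‖X‖) ^ ⌈σ⌉₊ := by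
      refine (Real.rpow_le_rpow_of_exponent_le
        (by linarith [Real.sqrt_nonneg (‖X.1‖ ^ 2 + ‖X.2‖ ^ 2)]) (Nat.le_ceil σ)).trans ?_
      rw [Real.rpow_natCast, ← mul_pow]
      gcongr
      linarith
    rw [div_mul_eq_mul_div, mul_assoc]
    gcongr
  · have hcomp : ∀ m : ℕ, p + (m : ℝ) • b (Sum.inr 0)
        = (p.1, p.2 + (m : ℝ) • EuclideanSpace.single 0 (1 : ℝ)) := fun m => by
      simp [hbr, Prod.add_def]
    simp only [hcomp]
    refine (hdecay p.1).comp (tendsto_comap_iff.2 ?_)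
    refine tendsto_atTop_mono (f := fun m : ℕ => (m : ℝ) - ‖p.2‖) (fun m => ?_)
      (tendsto_atTop_add_const_right _ _ tendsto_natCast_atTop_atTop)
    have := norm_sub_norm_le ((m : ℝ) • EuclideanSpace.single (0 : Fin 2) (1 : ℝ)) (-p.2)
    simpa [norm_smul, add_comm] using this
end
end

section
/- Let N ≥ 1 be an integer, let u ∈ L^1_0(ℝ^N), and suppose that u is Dini continuous at a point x ∈ ℝ^N. Then the limit ℓ := lim_{t→0⁺} ( w_u(x,t) + u(x) ln t ) exists in ℝ, the principal value integral defining L_Δ u(x) converges, and L_Δ u(x) = 2 (ln 2 − γ) u(x) − 2 ℓ. -/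
open MeasureTheory Real Filter Topology Set Metric

noncomputable section

/-- The digamma function `ψ = Γ'/Γ`. -/
def digammaFn (x : ℝ) : ℝ := deriv Real.Gamma x / Real.Gamma x

/-- The Euler–Mascheroni constant `γ = −Γ'(1)`. -/
def eulerGamma : ℝ := -(deriv Real.Gamma 1)

/-- The constant `ρ_N = 2 ln 2 + ψ(N/2) − γ`. -/
def rhoN (N : ℕ) : ℝ := 2 * Real.log 2 + digammaFn ((N : ℝ) / 2) - eulerGamma

/-- The primitive, vanishing at `0`, of `s ↦ s ^ n * (1 + s ^ 2) ^ (-(n + 1) / 2)`. -/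
def radialPrimitive : ℕ → ℝ → ℝ
  | 0, s => Real.arsinh s
  | 1, s => Real.log (1 + s ^ 2) / 2
  | (n + 2), s => radialPrimitive n s
      - s ^ (n + 1) * (1 + s ^ 2) ^ (-((n : ℝ) + 1) / 2) / ((n : ℝ) + 1)

lemma radialPrimitive_zero_right (n : ℕ) : radialPrimitive n 0 = 0 := by
  induction n using Nat.twoStepInduction with
  | zero => simp [radialPrimitive]
  | one => simp [radialPrimitive]
  | more n ih _ => simp [radialPrimitive, ih]

lemma hasDerivAt_radialPrimitive (n : ℕ) (s : ℝ) :
    HasDerivAt (radialPrimitive n) (s ^ n * (1 + s ^ 2) ^ (-((n : ℝ) + 1) / 2)) s := by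
  have hpos : 0 < 1 + s ^ 2 := by positivity
  induction n using Nat.twoStepInduction with
  | zero =>
    have h := Real.hasDerivAt_arsinh s
    have e : (√(1 + s ^ 2))⁻¹ = s ^ 0 * (1 + s ^ 2) ^ (-(((0 : ℕ) : ℝ) + 1) / 2) := by
      rw [Real.sqrt_eq_rpow, ← Real.rpow_neg hpos.le]
      norm_num
    rw [e] at h
    exact h
  | one =>
    have h := (((hasDerivAt_pow 2 s).const_add 1).log hpos.ne').div_const 2
    refine HasDerivAt.congr_deriv (f := radialPrimitive 1) h ?_
    norm_num
    rw [Real.rpow_neg_one]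
    field_simp
  | more n ih _ =>
    have h1 : HasDerivAt (fun s : ℝ => 1 + s ^ 2) (2 * s) s := by
      simpa using ((hasDerivAt_id s).pow 2).const_add 1
    have h2 := h1.rpow_const (p := -((n : ℝ) + 1) / 2) (Or.inl hpos.ne')
    have h3 := ih.sub (((hasDerivAt_pow (n + 1) s).mul h2).div_const ((n : ℝ) + 1))
    refine h3.congr_deriv ?_
    have e1 : (1 + s ^ 2) ^ (-((n : ℝ) + 1) / 2)
        = (1 + s ^ 2) ^ (-((n : ℝ) + 1) / 2 - 1) * (1 + s ^ 2) := by
      rw [← Real.rpow_add_one hpos.ne', sub_add_cancel]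
    have e2 : -(((n + 2 : ℕ) : ℝ) + 1) / 2 = -((n : ℝ) + 1) / 2 - 1 := by push_cast; ring
    rw [e1, e2]
    have : (n : ℝ) + 1 ≠ 0 := by positivity
    push_cast
    field_simp
    ring

lemma digammaFn_add_one {a : ℝ} (ha : 0 < a) : digammaFn (a + 1) = digammaFn a + 1 / a := by
  have hd : DifferentiableAt ℝ Real.Gamma a :=
    Real.differentiableAt_Gamma fun m ↦ ((neg_nonpos.mpr m.cast_nonneg).trans_lt ha).ne'
  have h1 : deriv Real.Gamma (a + 1) = Real.Gamma a + a * deriv Real.Gamma a := by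
    rw [← deriv_comp_add_const]
    have : (fun x => Real.Gamma (x + 1)) =ᶠ[𝓝 a] fun x => x * Real.Gamma x := by
      filter_upwards [lt_mem_nhds ha] with x hx using Real.Gamma_add_one hx.ne'
    rw [this.deriv_eq]
    have h := ((hasDerivAt_id' a).mul hd.hasDerivAt).deriv
    rw [one_mul] at h
    exact h
  have := (Real.Gamma_pos_of_pos ha).ne'
  rw [digammaFn, digammaFn, h1, Real.Gamma_add_one ha.ne']
  field_simp
  ring

lemma digammaFn_one : digammaFn 1 = -eulerGamma := by
  simp [digammaFn, eulerGamma]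

lemma digammaFn_one_half : digammaFn (1 / 2) = -eulerGamma - 2 * Real.log 2 := by
  have : √π ≠ 0 := by positivity
  rw [digammaFn, Real.hasDerivAt_Gamma_one_half.deriv, Real.Gamma_one_half_eq, eulerGamma,
    ← Real.eulerMascheroniConstant_eq_neg_deriv]
  field_simp
  ring

lemma tendsto_one_add_inv_sq : Tendsto (fun s : ℝ => 1 + (s⁻¹) ^ 2) atTop (𝓝 1) := by
  simpa using (tendsto_inv_atTop_zero (𝕜 := ℝ)).pow 2 |>.const_add 1

lemma tendsto_radialPrimitive_sub_log (n : ℕ) :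
    Tendsto (fun s => radialPrimitive n s - Real.log s) atTop
      (𝓝 (-(eulerGamma + digammaFn (((n : ℝ) + 1) / 2)) / 2)) := by
  have hsq : ∀ s : ℝ, 0 < s → 1 + s ^ 2 = s ^ 2 * (1 + (s⁻¹) ^ 2) := fun s hs => by
    field_simp
    ring
  induction n using Nat.twoStepInduction with
  | zero =>
    have h : Tendsto (fun s : ℝ => Real.log (1 + √(1 + (s⁻¹) ^ 2))) atTop
        (𝓝 (Real.log (1 + √1))) :=
      (tendsto_one_add_inv_sq.sqrt.const_add 1).log (by positivity)
    have e : -(eulerGamma + digammaFn ((((0 : ℕ) : ℝ) + 1) / 2)) / 2 = Real.log (1 + √1) := by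
      have := digammaFn_one_half
      norm_num at this ⊢
      rw [this]
      ring
    rw [e]
    refine h.congr' ?_
    filter_upwards [eventually_gt_atTop 0] with s hs
    simp only [radialPrimitive, Real.arsinh]
    rw [← Real.log_div (by positivity) hs.ne', hsq s hs, Real.sqrt_mul (by positivity),
      Real.sqrt_sq hs.le]
    congr 1
    field_simp
  | one =>
    have h : Tendsto (fun s : ℝ => Real.log (1 + (s⁻¹) ^ 2) / 2) atTop (𝓝 (Real.log 1 / 2)) :=
      (tendsto_one_add_inv_sq.log one_ne_zero).div_const 2
    have e : -(eulerGamma + digammaFn ((((1 : ℕ) : ℝ) + 1) / 2)) / 2 = Real.log 1 / 2 := by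
      have := digammaFn_one
      norm_num
      rw [this]
      ring
    rw [e]
    refine h.congr' ?_
    filter_upwards [eventually_gt_atTop 0] with s hs
    simp only [radialPrimitive]
    rw [hsq s hs, Real.log_mul (by positivity) (by positivity), Real.log_pow]
    push_cast
    ring
  | more n ih _ =>
    have h : Tendsto (fun s : ℝ => (1 + (s⁻¹) ^ 2) ^ (-((n : ℝ) + 1) / 2)) atTop
        (𝓝 (1 ^ (-((n : ℝ) + 1) / 2))) :=
      tendsto_one_add_inv_sq.rpow_const (Or.inl one_ne_zero)
    have hn : (n : ℝ) + 1 ≠ 0 := by positivity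
    have h2 := ih.sub (h.div_const ((n : ℝ) + 1))
    have e : -(eulerGamma + digammaFn ((((n + 2 : ℕ) : ℝ) + 1) / 2)) / 2
        = -(eulerGamma + digammaFn (((n : ℝ) + 1) / 2)) / 2
          - 1 ^ (-((n : ℝ) + 1) / 2) / ((n : ℝ) + 1) := by
      have e1 : (((n + 2 : ℕ) : ℝ) + 1) / 2 = ((n : ℝ) + 1) / 2 + 1 := by push_cast; ring
      rw [e1, digammaFn_add_one (by positivity), Real.one_rpow]
      field_simp
      ring
    rw [e]
    refine h2.congr' ?_
    filter_upwards [eventually_gt_atTop 0] with s hs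
    have e2 : s ^ (n + 1) * (s ^ 2) ^ (-((n : ℝ) + 1) / 2) = 1 := by
      rw [← Real.rpow_natCast s (n + 1), ← Real.rpow_natCast s 2, ← Real.rpow_mul hs.le,
        ← Real.rpow_add hs]
      push_cast
      convert Real.rpow_zero s using 2
      ring
    have e3 : s ^ (n + 1) * (1 + s ^ 2) ^ (-((n : ℝ) + 1) / 2)
        = (1 + (s⁻¹) ^ 2) ^ (-((n : ℝ) + 1) / 2) := by
      rw [hsq s hs, Real.mul_rpow (by positivity) (by positivity), ← mul_assoc, e2, one_mul]
    simp only [radialPrimitive]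
    rw [e3]
    ring

lemma cN_mul_sphere_area (n : ℕ) :
    cN (n + 1) / 2 * ((n + 1 : ℕ) *
      volume.real (ball (0 : EuclideanSpace ℝ (Fin (n + 1))) 1)) = 1 := by
  have hg : 0 < Real.Gamma (((n : ℝ) + 1) / 2) := Real.Gamma_pos_of_pos (by positivity)
  have hp : √π ^ (n + 1) = π ^ (((n : ℝ) + 1) / 2) := by
    rw [Real.sqrt_eq_rpow, ← Real.rpow_natCast, ← Real.rpow_mul Real.pi_pos.le]
    push_cast
    congr 1
    ring
  have hpp : 0 < π ^ (((n : ℝ) + 1) / 2) := Real.rpow_pos_of_pos Real.pi_pos _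
  rw [Measure.real, EuclideanSpace.volume_ball]
  simp only [Fintype.card_fin, ENNReal.ofReal_one, one_pow, one_mul]
  push_cast
  have hG := Real.Gamma_add_one (s := ((n : ℝ) + 1) / 2) (by positivity)
  rw [hG, ENNReal.toReal_ofReal (by positivity), hp, cN]
  push_cast
  field_simp

lemma rpow_scaling (n : ℕ) {r t : ℝ} (ht : 0 < t) :
    t⁻¹ * ((r * t⁻¹) ^ n * (1 + (r * t⁻¹) ^ 2) ^ (-((n : ℝ) + 1) / 2))
      = r ^ n * (r ^ 2 + t ^ 2) ^ (-((n : ℝ) + 1) / 2) := by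
  have e : r ^ 2 + t ^ 2 = t ^ 2 * (1 + (r * t⁻¹) ^ 2) := by
    field_simp
    ring
  have e2 : (t ^ 2) ^ (-((n : ℝ) + 1) / 2) = (t⁻¹) ^ (n + 1) := by
    rw [← Real.rpow_natCast t 2, ← Real.rpow_mul ht.le, inv_pow, ← Real.rpow_natCast t (n + 1),
      ← Real.rpow_neg ht.le]
    push_cast
    congr 1
    ring
  rw [e, Real.mul_rpow (by positivity) (by positivity), e2]
  ring

lemma integral_radial_kernel (n : ℕ) {t : ℝ} (ht : 0 < t) :
    ∫ r in (0 : ℝ)..1, r ^ n * (r ^ 2 + t ^ 2) ^ (-((n : ℝ) + 1) / 2)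
      = radialPrimitive n t⁻¹ := by
  have hd : ∀ r : ℝ, HasDerivAt (fun r => radialPrimitive n (r * t⁻¹))
      (r ^ n * (r ^ 2 + t ^ 2) ^ (-((n : ℝ) + 1) / 2)) r := fun r => by
    have h := (hasDerivAt_radialPrimitive n (r * t⁻¹)).comp r
      ((hasDerivAt_id' r).mul_const t⁻¹)
    refine h.congr_deriv ?_
    rw [← rpow_scaling n ht]
    ring
  have hc : Continuous fun r : ℝ => r ^ n * (r ^ 2 + t ^ 2) ^ (-((n : ℝ) + 1) / 2) :=
    (continuous_pow n).mul (((continuous_pow 2).add continuous_const).rpow_const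
      fun r => Or.inl (add_pos_of_nonneg_of_pos (sq_nonneg r) (pow_pos ht 2)).ne')
  rw [intervalIntegral.integral_eq_sub_of_hasDerivAt (fun r _ => hd r)
    (hc.intervalIntegrable 0 1)]
  simp [radialPrimitive_zero_right]

lemma integral_ball_kernel (n : ℕ) {t : ℝ} (ht : 0 < t) :
    cN (n + 1) / 2 * ∫ y in ball (0 : EuclideanSpace ℝ (Fin (n + 1))) 1,
      (‖y‖ ^ 2 + t ^ 2) ^ (-((n + 1 : ℕ) : ℝ) / 2) = radialPrimitive n t⁻¹ := by
  set g : ℝ → ℝ := (Iio 1).indicator fun r => (r ^ 2 + t ^ 2) ^ (-((n + 1 : ℕ) : ℝ) / 2)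
  have h1 : ∫ y in ball (0 : EuclideanSpace ℝ (Fin (n + 1))) 1,
      (‖y‖ ^ 2 + t ^ 2) ^ (-((n + 1 : ℕ) : ℝ) / 2)
      = ∫ y : EuclideanSpace ℝ (Fin (n + 1)), g ‖y‖ := by
    rw [← integral_indicator measurableSet_ball]
    congr 1 with y
    simp [g, indicator]
  have h2 : ∫ r in Ioi (0 : ℝ), r ^ n • g r = radialPrimitive n t⁻¹ := by
    rw [← integral_radial_kernel n ht, intervalIntegral.integral_of_le zero_le_one,
      integral_Ioc_eq_integral_Ioo, ← integral_indicator measurableSet_Ioi,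
      ← integral_indicator measurableSet_Ioo]
    congr 1 with r
    by_cases h0 : 0 < r <;> by_cases h1 : r < 1 <;> simp [g, indicator, h0, h1]
  rw [h1, integral_fun_norm_addHaar volume g, finrank_euclideanSpace_fin, Nat.add_sub_cancel, h2,
    nsmul_eq_mul, smul_eq_mul]
  have := cN_mul_sphere_area n
  linear_combination radialPrimitive n t⁻¹ * this

lemma integrableOn_dini_ball (n : ℕ) {v : EuclideanSpace ℝ (Fin (n + 1)) → ℝ}
    (hv : LocallyIntegrable v volume) {a : ℝ} {ω : ℝ → ℝ}
    (hω : ∀ r ∈ Ioc (0 : ℝ) 1, ∀ y, ‖y‖ < r → |v y - a| ≤ ω r)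
    (hi : IntegrableOn (fun r => ω r / r) (Ioc (0 : ℝ) 1) volume) :
    IntegrableOn (fun y => (v y - a) * ‖y‖ ^ (-((n + 1 : ℕ) : ℝ))) (ball 0 1) volume := by
  have hm : AEStronglyMeasurable (fun y => (v y - a) * ‖y‖ ^ (-((n + 1 : ℕ) : ℝ))) volume :=
    (hv.aestronglyMeasurable.sub aestronglyMeasurable_const).mul
      (measurable_norm.pow_const _).aestronglyMeasurable
  have hnear : IntegrableOn (fun y => (v y - a) * ‖y‖ ^ (-((n + 1 : ℕ) : ℝ)))
      (ball 0 (1 / 2)) volume := by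
    have hmaj : IntegrableOn (fun y : EuclideanSpace ℝ (Fin (n + 1)) =>
        (fun r : ℝ => ω (2 * r) * r ^ (-((n + 1 : ℕ) : ℝ))) ‖y‖) (ball 0 (1 / 2)) volume := by
      refine (integrableOn_fun_norm_addHaar
        (volume : Measure (EuclideanSpace ℝ (Fin (n + 1))))
        (f := fun r : ℝ => ω (2 * r) * r ^ (-((n + 1 : ℕ) : ℝ)))).2 ?_
      rw [finrank_euclideanSpace_fin, Nat.add_sub_cancel]
      have h1 : IntervalIntegrable (fun r => ω r / r) volume 0 1 :=
        (intervalIntegrable_iff_integrableOn_Ioc_of_le zero_le_one).2 hi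
      have h2 := (h1.comp_mul_left (c := 2)).const_mul 2
      rw [zero_div, intervalIntegrable_iff_integrableOn_Ioc_of_le (by norm_num)] at h2
      refine (h2.mono_set Ioo_subset_Ioc_self).congr_fun (fun r hr => ?_) measurableSet_Ioo
      have hr0 : 0 < r := hr.1
      simp only [smul_eq_mul]
      rw [Real.rpow_neg hr0.le, Real.rpow_natCast]
      field_simp
      ring
    refine Integrable.mono' hmaj hm.restrict ?_
    refine (ae_restrict_iff' measurableSet_ball).2 (Eventually.of_forall fun y hy => ?_)
    rcases eq_or_ne y 0 with rfl | hy0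
    · simp only [norm_zero]
      rw [Real.zero_rpow (neg_ne_zero.2 (Nat.cast_ne_zero.2 n.succ_ne_zero))]
      simp
    · have hpos := norm_pos_iff.2 hy0
      rw [mem_ball_zero_iff] at hy
      rw [norm_mul, Real.norm_eq_abs, Real.norm_of_nonneg (by positivity)]
      exact mul_le_mul_of_nonneg_right
        (hω (2 * ‖y‖) ⟨by positivity, by linarith⟩ y (by linarith)) (by positivity)
  have hfar : IntegrableOn (fun y => (v y - a) * ‖y‖ ^ (-((n + 1 : ℕ) : ℝ)))
      (closedBall 0 1 \ ball 0 (1 / 2)) volume := by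
    have hK : IsCompact (closedBall (0 : EuclideanSpace ℝ (Fin (n + 1))) 1 \ ball 0 (1 / 2)) :=
      (isCompact_closedBall 0 1).diff isOpen_ball
    have hint : IntegrableOn (fun y => v y - a)
        (closedBall (0 : EuclideanSpace ℝ (Fin (n + 1))) 1 \ ball 0 (1 / 2)) volume :=
      (hv.integrableOn_isCompact hK).sub
        (integrableOn_const hK.measure_lt_top.ne)
    refine Integrable.mono' (hint.norm.mul_const ((1 / 2 : ℝ) ^ (-((n + 1 : ℕ) : ℝ))))
      hm.restrict ?_
    refine (ae_restrict_iff' (measurableSet_closedBall.diff measurableSet_ball)).2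
      (Eventually.of_forall fun y hy => ?_)
    have hy2 : 1 / 2 ≤ ‖y‖ := by simpa using hy.2
    rw [norm_mul, Real.norm_of_nonneg (r := ‖y‖ ^ _) (by positivity)]
    exact mul_le_mul_of_nonneg_left
      (Real.rpow_le_rpow_of_nonpos (by norm_num) hy2 (neg_nonpos.2 (Nat.cast_nonneg _))) (norm_nonneg _)
  refine (hnear.union hfar).mono_set fun y hy => ?_
  by_cases h : y ∈ ball 0 (1 / 2)
  · exact Or.inl h
  · exact Or.inr ⟨ball_subset_closedBall hy, h⟩

lemma MemL10.integrableOn_compl_ball {N : ℕ} {u : EuclideanSpace ℝ (Fin N) → ℝ}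
    (hu : MemL10 N u) (x : EuclideanSpace ℝ (Fin N)) :
    IntegrableOn (fun y => u (x + y) * ‖y‖ ^ (-(N : ℝ))) {y | 1 ≤ ‖y‖} volume := by
  have hm : AEStronglyMeasurable (fun y => u (x + y)) volume :=
    hu.1.aestronglyMeasurable.comp_measurePreserving (measurePreserving_add_left volume x)
  have hmaj := (hu.2.comp_add_left x).const_mul ((2 + ‖x‖) ^ (N : ℝ))
  refine Integrable.mono' hmaj.integrableOn
    (hm.mul (measurable_norm.pow_const _).aestronglyMeasurable).restrict ?_
  refine (ae_restrict_iff' (measurableSet_le measurable_const measurable_norm)).2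
    (Eventually.of_forall fun y (hy : 1 ≤ ‖y‖) => ?_)
  rw [norm_mul, Real.norm_eq_abs, Real.norm_of_nonneg (by positivity), ← mul_assoc,
    mul_comm |u (x + y)|]
  refine mul_le_mul_of_nonneg_right ?_ (abs_nonneg _)
  have h1 : 1 + ‖x + y‖ ≤ (2 + ‖x‖) * ‖y‖ := by
    nlinarith [norm_add_le x y, norm_nonneg x]
  have h2 : ((2 + ‖x‖) * ‖y‖) ^ (-(N : ℝ)) ≤ (1 + ‖x + y‖) ^ (-(N : ℝ)) :=
    Real.rpow_le_rpow_of_nonpos (by positivity) h1 (by simp)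
  calc ‖y‖ ^ (-(N : ℝ))
      = (2 + ‖x‖) ^ (N : ℝ) * ((2 + ‖x‖) * ‖y‖) ^ (-(N : ℝ)) := by
        rw [Real.mul_rpow (by positivity) (by positivity), ← mul_assoc,
          ← Real.rpow_add (by positivity), add_neg_cancel, Real.rpow_zero, one_mul]
    _ ≤ _ := mul_le_mul_of_nonneg_left h2 (by positivity)

lemma kernel_le {N : ℕ} {E : Type*} [NormedAddCommGroup E] {y : E} (hy : y ≠ 0) (t : ℝ) :
    (‖y‖ ^ 2 + t ^ 2) ^ (-(N : ℝ) / 2) ≤ ‖y‖ ^ (-(N : ℝ)) := by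
  have hpos := norm_pos_iff.2 hy
  have e : ‖y‖ ^ (-(N : ℝ)) = (‖y‖ ^ 2) ^ (-(N : ℝ) / 2) := by
    rw [← Real.rpow_natCast ‖y‖ 2, ← Real.rpow_mul hpos.le]
    push_cast
    congr 1
    ring
  rw [e]
  exact Real.rpow_le_rpow_of_nonpos (by positivity) (by nlinarith [sq_nonneg t])
    (by have : (0 : ℝ) ≤ N := N.cast_nonneg
        linarith)

lemma tendsto_kernel {N : ℕ} {E : Type*} [NormedAddCommGroup E] {y : E} (hy : y ≠ 0) :
    Tendsto (fun t : ℝ => (‖y‖ ^ 2 + t ^ 2) ^ (-(N : ℝ) / 2)) (𝓝[>] 0)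
      (𝓝 (‖y‖ ^ (-(N : ℝ)))) := by
  have hpos := norm_pos_iff.2 hy
  have e : ‖y‖ ^ (-(N : ℝ)) = (‖y‖ ^ 2 + 0 ^ 2) ^ (-(N : ℝ) / 2) := by
    rw [zero_pow two_ne_zero, add_zero, ← Real.rpow_natCast ‖y‖ 2, ← Real.rpow_mul hpos.le]
    push_cast
    congr 1
    ring
  rw [e]
  have h : ContinuousAt (fun t : ℝ => (‖y‖ ^ 2 + t ^ 2) ^ (-(N : ℝ) / 2)) 0 :=
    ContinuousAt.rpow_const (by fun_prop) (Or.inl (by positivity))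
  exact h.tendsto.mono_left nhdsWithin_le_nhds

lemma integrable_mul_kernel {n : ℕ} {f : EuclideanSpace ℝ (Fin (n + 1)) → ℝ}
    (hm : AEStronglyMeasurable f volume)
    (hf : Integrable (fun y => f y * ‖y‖ ^ (-((n + 1 : ℕ) : ℝ))) volume) (t : ℝ) :
    Integrable (fun y => f y * (‖y‖ ^ 2 + t ^ 2) ^ (-((n + 1 : ℕ) : ℝ) / 2)) volume := by
  refine Integrable.mono' hf.norm (hm.mul
    (((measurable_norm.pow_const 2).add_const _).pow_const _).aestronglyMeasurable) ?_
  filter_upwards [Measure.ae_ne volume 0] with y hy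
  rw [norm_mul, norm_mul, Real.norm_of_nonneg (r := ‖y‖ ^ _) (by positivity),
    Real.norm_of_nonneg (r := (‖y‖ ^ 2 + t ^ 2) ^ _) (by positivity)]
  exact mul_le_mul_of_nonneg_left (kernel_le hy t) (norm_nonneg _)

lemma tendsto_integral_mul_kernel {n : ℕ} {f : EuclideanSpace ℝ (Fin (n + 1)) → ℝ}
    (hm : AEStronglyMeasurable f volume)
    (hf : Integrable (fun y => f y * ‖y‖ ^ (-((n + 1 : ℕ) : ℝ))) volume) :
    Tendsto (fun t : ℝ => ∫ y, f y * (‖y‖ ^ 2 + t ^ 2) ^ (-((n + 1 : ℕ) : ℝ) / 2)) (𝓝[>] 0)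
      (𝓝 (∫ y, f y * ‖y‖ ^ (-((n + 1 : ℕ) : ℝ)))) := by
  refine tendsto_integral_filter_of_dominated_convergence
    (fun y => ‖f y * ‖y‖ ^ (-((n + 1 : ℕ) : ℝ))‖) (Eventually.of_forall fun t => hm.mul
    (((measurable_norm.pow_const 2).add_const _).pow_const _).aestronglyMeasurable)
    (Eventually.of_forall fun t => ?_) hf.norm ?_
  · filter_upwards [Measure.ae_ne volume 0] with y hy
    rw [norm_mul, norm_mul, Real.norm_of_nonneg (r := ‖y‖ ^ _) (by positivity),
      Real.norm_of_nonneg (r := (‖y‖ ^ 2 + t ^ 2) ^ _) (by positivity)]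
    exact mul_le_mul_of_nonneg_left (kernel_le hy t) (norm_nonneg _)
  · filter_upwards [Measure.ae_ne volume 0] with y hy
    exact (tendsto_kernel hy).const_mul _

lemma tendsto_setIntegral_annulus {n : ℕ} {g : EuclideanSpace ℝ (Fin (n + 1)) → ℝ}
    (hg : IntegrableOn g (ball 0 1) volume) :
    Tendsto (fun ε : ℝ => ∫ y in {y | ε ≤ ‖y‖ ∧ ‖y‖ < 1}, g y) (𝓝[>] 0)
      (𝓝 (∫ y in ball 0 1, g y)) := by
  have hs : ∀ ε : ℝ, MeasurableSet {y : EuclideanSpace ℝ (Fin (n + 1)) | ε ≤ ‖y‖} := fun ε =>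
    measurableSet_le measurable_const measurable_norm
  have e : ∀ ε : ℝ, ∫ y in {y | ε ≤ ‖y‖ ∧ ‖y‖ < 1}, g y
      = ∫ y in ball 0 1, indicator {y | ε ≤ ‖y‖} g y := fun ε => by
    rw [setIntegral_indicator (hs ε)]
    congr 2
    ext y
    simp [and_comm]
  simp_rw [e]
  refine tendsto_integral_filter_of_dominated_convergence (fun y => ‖g y‖)
    (Eventually.of_forall fun ε => hg.aestronglyMeasurable.indicator (hs ε))
    (Eventually.of_forall fun ε => Eventually.of_forall fun y => norm_indicator_le_norm_self _ _)
    hg.norm ?_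
  filter_upwards [ae_restrict_of_ae (Measure.ae_ne volume 0)] with y hy
  refine tendsto_const_nhds.congr' ?_
  filter_upwards [mem_nhdsWithin_of_mem_nhds (gt_mem_nhds (norm_pos_iff.2 hy))] with ε hε
  exact (indicator_of_mem (s := {y | ε ≤ ‖y‖}) (show ε ≤ ‖y‖ from le_of_lt hε) g).symm

/-- if `u ∈ L^1_0(ℝ^N)` is Dini continuous at `x`, then
`ℓ = lim_{t→0⁺} (w_u(x,t) + u(x) ln t)` exists, the principal value integral
defining `L_Δ u(x)` converges, and `L_Δ u(x) = 2(ln 2 − γ) u(x) − 2ℓ`. -/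
theorem stmt9 (N : ℕ) (hN : 1 ≤ N) (u : EuclideanSpace ℝ (Fin N) → ℝ)
    (hu : MemL10 N u) (x : EuclideanSpace ℝ (Fin N))
    (hDini : ∃ ω : ℝ → ℝ,
      (∀ r ∈ Set.Ioc (0 : ℝ) 1, ∀ y : EuclideanSpace ℝ (Fin N),
        dist y x < r → |u y - u x| ≤ ω r) ∧
      MeasureTheory.IntegrableOn (fun r => ω r / r) (Set.Ioc (0 : ℝ) 1) volume) :
    ∃ ℓ PV : ℝ,
      Tendsto (fun t : ℝ => poissonExt N u x t + u x * Real.log t)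
        (𝓝[>] (0 : ℝ)) (𝓝 ℓ) ∧
      Tendsto (fun ε : ℝ =>
          ∫ y in {y : EuclideanSpace ℝ (Fin N) | ε ≤ ‖y‖ ∧ ‖y‖ < 1},
            (u x - u (x + y)) * ‖y‖ ^ (-(N : ℝ)))
        (𝓝[>] (0 : ℝ)) (𝓝 PV) ∧
      MeasureTheory.IntegrableOn
        (fun y : EuclideanSpace ℝ (Fin N) => u (x + y) * ‖y‖ ^ (-(N : ℝ)))
        {y : EuclideanSpace ℝ (Fin N) | 1 ≤ ‖y‖} volume ∧
      cN N * PV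
          - cN N * (∫ y in {y : EuclideanSpace ℝ (Fin N) | 1 ≤ ‖y‖},
              u (x + y) * ‖y‖ ^ (-(N : ℝ)))
          + rhoN N * u x
        = 2 * (Real.log 2 - eulerGamma) * u x - 2 * ℓ := by
  obtain ⟨n, rfl⟩ : ∃ n, N = n + 1 := ⟨N - 1, by omega⟩
  obtain ⟨ω, hω, hi⟩ := hDini
  have hv : LocallyIntegrable (fun y => u (x + y)) volume := by
    intro y
    have h : IntegrableAtFilter u (𝓝 (x + y)) volume := hu.1 (x + y)
    obtain ⟨s, hs, hint⟩ := h
    refine ⟨(x + ·) ⁻¹' s, (continuous_const_add x).continuousAt hs, ?_⟩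
    exact ((measurePreserving_add_left volume x).integrableOn_comp_preimage
      (measurableEmbedding_addLeft x)).2 hint
  have hm := hv.aestronglyMeasurable
  have hdini := integrableOn_dini_ball n hv (a := u x)
    (fun r hr y hy => hω r hr (x + y) (by simpa using hy)) hi
  have hout := hu.integrableOn_compl_ball x
  set B : Set (EuclideanSpace ℝ (Fin (n + 1))) := ball 0 1 with hB
  have hBm : MeasurableSet B := measurableSet_ball
  have hBc : {y : EuclideanSpace ℝ (Fin (n + 1)) | 1 ≤ ‖y‖} = Bᶜ := by
    ext y
    simp [B]
  set f : EuclideanSpace ℝ (Fin (n + 1)) → ℝ :=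
    fun y => u (x + y) - B.indicator (fun _ => u x) y with hf
  have hfm : AEStronglyMeasurable f volume :=
    hm.sub (aestronglyMeasurable_const.indicator hBm)
  have hf_in : EqOn (fun y => f y * ‖y‖ ^ (-((n + 1 : ℕ) : ℝ)))
      (fun y => (u (x + y) - u x) * ‖y‖ ^ (-((n + 1 : ℕ) : ℝ))) B := fun y hy => by
    simp only [hf, indicator_of_mem hy]
  have hf_out : EqOn (fun y => f y * ‖y‖ ^ (-((n + 1 : ℕ) : ℝ)))
      (fun y => u (x + y) * ‖y‖ ^ (-((n + 1 : ℕ) : ℝ))) Bᶜ := fun y hy => by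
    simp only [hf, indicator_of_notMem hy, sub_zero]
  have hfi : Integrable (fun y => f y * ‖y‖ ^ (-((n + 1 : ℕ) : ℝ))) volume := by
    rw [← integrableOn_univ, ← union_compl_self B]
    exact (hdini.congr_fun hf_in.symm hBm).union
      ((hBc ▸ hout).congr_fun hf_out.symm hBm.compl)
  have hsplit : ∫ y, f y * ‖y‖ ^ (-((n + 1 : ℕ) : ℝ))
      = (∫ y in B, (u (x + y) - u x) * ‖y‖ ^ (-((n + 1 : ℕ) : ℝ)))
        + ∫ y in {y | 1 ≤ ‖y‖}, u (x + y) * ‖y‖ ^ (-((n + 1 : ℕ) : ℝ)) := by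
    rw [← integral_add_compl hBm hfi, setIntegral_congr_fun hBm hf_in,
      setIntegral_congr_fun hBm.compl hf_out, hBc]
  have hw : ∀ t : ℝ, 0 < t → poissonExt (n + 1) u x t
      = cN (n + 1) / 2 * (∫ y, f y * (‖y‖ ^ 2 + t ^ 2) ^ (-((n + 1 : ℕ) : ℝ) / 2))
        + u x * radialPrimitive n t⁻¹ := by
    intro t ht
    have hk : IntegrableOn (fun y : EuclideanSpace ℝ (Fin (n + 1)) =>
        u x * (‖y‖ ^ 2 + t ^ 2) ^ (-((n + 1 : ℕ) : ℝ) / 2)) B volume := by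
      have hc : Continuous (fun y : EuclideanSpace ℝ (Fin (n + 1)) =>
          u x * (‖y‖ ^ 2 + t ^ 2) ^ (-((n + 1 : ℕ) : ℝ) / 2)) :=
        continuous_const.mul (((continuous_norm.pow 2).add continuous_const).rpow_const
          fun y => Or.inl (add_pos_of_nonneg_of_pos (sq_nonneg _) (pow_pos ht 2)).ne')
      exact (hc.continuousOn.integrableOn_compact (isCompact_closedBall 0 1)).mono_set
        ball_subset_closedBall
    have e : ∫ y, u y * (‖x - y‖ ^ 2 + t ^ 2) ^ (-((n + 1 : ℕ) : ℝ) / 2)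
        = (∫ y, f y * (‖y‖ ^ 2 + t ^ 2) ^ (-((n + 1 : ℕ) : ℝ) / 2))
          + ∫ y in B, u x * (‖y‖ ^ 2 + t ^ 2) ^ (-((n + 1 : ℕ) : ℝ) / 2) := by
      rw [← integral_indicator hBm, ← integral_add (integrable_mul_kernel hfm hfi t)
        ((integrable_indicator_iff hBm).2 hk),
        ← integral_add_left_eq_self
          (fun y => u y * (‖x - y‖ ^ 2 + t ^ 2) ^ (-((n + 1 : ℕ) : ℝ) / 2)) x]
      congr 1 with y
      rw [sub_add_cancel_left, norm_neg]
      by_cases hy : y ∈ B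
      · simp only [hf, indicator_of_mem hy]
        ring
      · simp only [hf, indicator_of_notMem hy]
        ring
    rw [poissonExt, e, integral_const_mul, ← integral_ball_kernel n ht]
    ring
  have hlim := ((tendsto_integral_mul_kernel hfm hfi).const_mul (cN (n + 1) / 2)).add
    (((tendsto_radialPrimitive_sub_log n).comp tendsto_inv_nhdsGT_zero).const_mul (u x))
  have hg : IntegrableOn
      (fun y => (u x - u (x + y)) * ‖y‖ ^ (-((n + 1 : ℕ) : ℝ))) B volume :=
    hdini.neg.congr_fun (fun y _ => by simp only [Pi.neg_apply]; ring) hBm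
  have hneg : ∫ y in B, (u x - u (x + y)) * ‖y‖ ^ (-((n + 1 : ℕ) : ℝ))
      = -∫ y in B, (u (x + y) - u x) * ‖y‖ ^ (-((n + 1 : ℕ) : ℝ)) := by
    rw [← integral_neg]
    congr 1 with y
    ring
  refine ⟨_, _, hlim.congr' ?_, tendsto_setIntegral_annulus hg, hout, ?_⟩
  · filter_upwards [self_mem_nhdsWithin] with t ht
    rw [hw t ht, Function.comp_apply, Real.log_inv]
    ring
  · rw [hsplit, hneg, rhoN]
    push_cast
    ring
end
end

section
/- (Weak unique continuation for the logarithmic Laplacian.) Let N ≥ 1 be an integer and let u ∈ L^1_0(ℝ^N). Suppose there is a nonempty open subset Ω ⊂ ℝ^N such that u = 0 almost everywhere in Ω and ∫_{ℝ^N} u(x) L_Δ φ(x) dx = 0 for every φ ∈ C_c^∞(Ω). Then u = 0 almost everywhere on ℝ^N. -/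
open MeasureTheory Real Filter Topology Set Metric

noncomputable section

/-- The kernel `⟪v, h⟫ ^ m / ‖v‖ ^ n`. -/
def dirKernel {N : ℕ} (m n : ℕ) (h v : EuclideanSpace ℝ (Fin N)) : ℝ :=
  inner ℝ v h ^ m * (‖v‖ ^ n)⁻¹

lemma measurable_dirKernel {N : ℕ} (m n : ℕ) (h : EuclideanSpace ℝ (Fin N)) :
    Measurable (dirKernel m n h) := by
  unfold dirKernel
  fun_prop

lemma abs_dirKernel_le {N m n : ℕ} (hn : N + m ≤ n) (h : EuclideanSpace ℝ (Fin N)) {r : ℝ}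
    (hr : 0 < r) :
    ∃ C, 0 ≤ C ∧ ∀ v, r ≤ ‖v‖ → |dirKernel m n h v| ≤ C * (‖v‖ ^ N)⁻¹ := by
  obtain ⟨j, rfl⟩ := Nat.exists_eq_add_of_le hn
  refine ⟨‖h‖ ^ m * (r ^ j)⁻¹, by positivity, fun v hv => ?_⟩
  have hv0 : 0 < ‖v‖ := hr.trans_le hv
  have h1 : |inner ℝ v h| ^ m ≤ (‖v‖ * ‖h‖) ^ m :=
    pow_le_pow_left₀ (abs_nonneg _) (abs_real_inner_le_norm v h) m
  have h2 : (‖v‖ ^ j)⁻¹ ≤ (r ^ j)⁻¹ := by gcongr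
  unfold dirKernel
  rw [abs_mul, abs_pow, abs_of_pos (a := (‖v‖ ^ (N + m + j))⁻¹) (by positivity)]
  calc |inner ℝ v h| ^ m * (‖v‖ ^ (N + m + j))⁻¹
      ≤ (‖v‖ * ‖h‖) ^ m * (‖v‖ ^ (N + m + j))⁻¹ := by gcongr
    _ = ‖h‖ ^ m * (‖v‖ ^ j)⁻¹ * (‖v‖ ^ N)⁻¹ := by
        rw [pow_add, pow_add, mul_pow]; field_simp
    _ ≤ _ := by gcongr

/-- Far from the centre, translates of the kernel are controlled by the weight of `L^1_0`. -/
lemma abs_mul_dirKernel_sub_le {N m n : ℕ} (hn : N + m ≤ n) (h : EuclideanSpace ℝ (Fin N))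
    {r : ℝ} (hr : 0 < r) (x₀ : EuclideanSpace ℝ (Fin N)) {u : EuclideanSpace ℝ (Fin N) → ℝ}
    (hz : ∀ x, u x ≠ 0 → 2 * r ≤ ‖x - x₀‖) :
    ∃ C, 0 ≤ C ∧ ∀ x, ∀ a ∈ ball x₀ r, |u x * dirKernel m n h (x - a)| ≤
      C * ((1 + ‖x‖) ^ (-(N : ℝ)) * |u x|) := by
  obtain ⟨C, hC, hb⟩ := abs_dirKernel_le hn h hr
  set K : ℝ := (1 + ‖x₀‖ + r) / r + 1 with hK
  have hK0 : 0 < K := by positivity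
  refine ⟨C * K ^ N, by positivity, fun x a ha => ?_⟩
  by_cases hx : u x = 0
  · simp [hx]
  have hxa : r ≤ ‖x - a‖ := by
    have h1 := hz x hx
    have h2 : ‖a - x₀‖ < r := by simpa [dist_eq_norm] using ha
    have h3 : ‖x - x₀‖ ≤ ‖x - a‖ + ‖a - x₀‖ := norm_sub_le_norm_sub_add_norm_sub ..
    linarith
  have hle : 1 + ‖x‖ ≤ K * ‖x - a‖ := by
    have h2 : ‖a - x₀‖ < r := by simpa [dist_eq_norm] using ha
    have h3 : ‖x‖ ≤ ‖x - a‖ + ‖a - x₀‖ + ‖x₀‖ := by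
      calc ‖x‖ = ‖(x - a) + (a - x₀) + x₀‖ := by congr 1; abel
        _ ≤ _ := norm_add₃_le
    have h4 : 1 + ‖x₀‖ + r ≤ (1 + ‖x₀‖ + r) / r * ‖x - a‖ := by
      rw [div_mul_eq_mul_div, le_div_iff₀ hr]
      gcongr
    rw [hK, add_mul, one_mul]
    linarith
  have hxa0 : 0 < ‖x - a‖ := hr.trans_le hxa
  have hw : (‖x - a‖ ^ N)⁻¹ ≤ K ^ N * (1 + ‖x‖) ^ (-(N : ℝ)) := by
    rw [Real.rpow_neg (by positivity), Real.rpow_natCast, ← div_eq_mul_inv, le_div_iff₀ (by positivity),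
      inv_mul_le_iff₀ (by positivity), ← mul_pow, mul_comm ‖x - a‖]
    gcongr
  rw [abs_mul]
  calc |u x| * |dirKernel m n h (x - a)| ≤ |u x| * (C * (‖x - a‖ ^ N)⁻¹) := by
        gcongr; exact hb _ hxa
    _ ≤ |u x| * (C * (K ^ N * (1 + ‖x‖) ^ (-(N : ℝ)))) := by gcongr
    _ = _ := by ring

lemma aestronglyMeasurable_mul_dirKernel {N : ℕ} (m n : ℕ) (h : EuclideanSpace ℝ (Fin N))
    {u : EuclideanSpace ℝ (Fin N) → ℝ} (hm : AEStronglyMeasurable u volume)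
    (a : EuclideanSpace ℝ (Fin N)) :
    AEStronglyMeasurable (fun x => u x * dirKernel m n h (x - a)) volume :=
  hm.mul ((measurable_dirKernel m n h).comp (measurable_id.sub_const a)).aestronglyMeasurable

lemma integrable_mul_dirKernel {N m n : ℕ} (hn : N + m ≤ n) (h : EuclideanSpace ℝ (Fin N))
    {r : ℝ} (hr : 0 < r) {x₀ : EuclideanSpace ℝ (Fin N)} {u : EuclideanSpace ℝ (Fin N) → ℝ}
    (hm : AEStronglyMeasurable u volume)
    (hW : Integrable (fun x => (1 + ‖x‖) ^ (-(N : ℝ)) * |u x|) volume)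
    (hz : ∀ x, u x ≠ 0 → 2 * r ≤ ‖x - x₀‖) {a : EuclideanSpace ℝ (Fin N)} (ha : a ∈ ball x₀ r) :
    Integrable (fun x => u x * dirKernel m n h (x - a)) volume := by
  obtain ⟨C, -, hb⟩ := abs_mul_dirKernel_sub_le hn h hr x₀ hz
  exact (hW.const_mul C).mono' (aestronglyMeasurable_mul_dirKernel m n h hm a)
    (ae_of_all _ fun x => hb x a ha)

lemma hasDerivAt_dirKernel {N : ℕ} (m n : ℕ) (h w : EuclideanSpace ℝ (Fin N)) (t : ℝ)
    (hw : w - t • h ≠ 0) :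
    HasDerivAt (fun s : ℝ => dirKernel m n h (w - s • h))
      (-(m * ‖h‖ ^ 2) * dirKernel (m - 1) n h (w - t • h)
        + n * dirKernel (m + 1) (n + 2) h (w - t • h)) t := by
  have hl : HasDerivAt (fun s : ℝ => w - s • h) (-h) t := by
    simpa using ((hasDerivAt_id t).smul_const h).const_sub w
  have hi : HasDerivAt (fun s : ℝ => inner ℝ (w - s • h) h) (-‖h‖ ^ 2) t := by
    simpa using hl.inner ℝ (hasDerivAt_const t h)
  have hpos : 0 < ‖w - t • h‖ := norm_pos_iff.2 hw
  have hnm : HasDerivAt (fun s : ℝ => ‖w - s • h‖)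
      (-(inner ℝ (w - t • h) h) / ‖w - t • h‖) t := by
    have h1 := (hl.norm_sq).sqrt (by positivity)
    simp only [Real.sqrt_sq (norm_nonneg _), inner_neg_right] at h1
    convert h1 using 1
    field_simp
  have h2 := (hi.pow m).mul ((hnm.pow n).inv (pow_pos hpos n).ne')
  unfold dirKernel
  refine h2.congr_deriv ?_
  simp only [Pi.pow_apply, Pi.inv_apply]
  rcases n with _ | n
  · simp; ring
  · simp only [Nat.add_sub_cancel, pow_succ]
    push_cast
    field_simp

/-- Differentiating `a ↦ ∫ u(x) K(x - a) dx` in direction `h` inside a ball on which it vanishes. -/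
lemma integral_deriv_dirKernel_eq_zero {N m n : ℕ} (hn : N + m ≤ n)
    (h : EuclideanSpace ℝ (Fin N))
    {r : ℝ} (hr : 0 < r) {x₀ : EuclideanSpace ℝ (Fin N)} {u : EuclideanSpace ℝ (Fin N) → ℝ}
    (hm : AEStronglyMeasurable u volume)
    (hW : Integrable (fun x => (1 + ‖x‖) ^ (-(N : ℝ)) * |u x|) volume)
    (hz : ∀ x, u x ≠ 0 → 2 * r ≤ ‖x - x₀‖)
    (h0 : ∀ a ∈ ball x₀ r, ∫ x, u x * dirKernel m n h (x - a) = 0)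
    {a : EuclideanSpace ℝ (Fin N)} (ha : a ∈ ball x₀ r) :
    -(m * ‖h‖ ^ 2) * (∫ x, u x * dirKernel (m - 1) n h (x - a))
      + n * (∫ x, u x * dirKernel (m + 1) (n + 2) h (x - a)) = 0 := by
  have hn1 : N + (m - 1) ≤ n := by omega
  have hn2 : N + (m + 1) ≤ n + 2 := by omega
  obtain ⟨C₁, -, hb₁⟩ := abs_mul_dirKernel_sub_le hn1 h hr x₀ hz
  obtain ⟨C₂, -, hb₂⟩ := abs_mul_dirKernel_sub_le hn2 h hr x₀ hz
  have hi₁ := integrable_mul_dirKernel hn1 h hr hm hW hz ha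
  have hi₂ := integrable_mul_dirKernel hn2 h hr hm hW hz ha
  set s : Set ℝ := (fun t : ℝ => a + t • h) ⁻¹' ball x₀ r with hs
  have hsn : s ∈ 𝓝 (0 : ℝ) := by
    refine ((isOpen_ball).preimage (by fun_prop)).mem_nhds ?_
    simpa using ha
  let F' : ℝ → EuclideanSpace ℝ (Fin N) → ℝ := fun t x =>
    -(m * ‖h‖ ^ 2) * (u x * dirKernel (m - 1) n h (x - (a + t • h)))
      + n * (u x * dirKernel (m + 1) (n + 2) h (x - (a + t • h)))
  have key := hasDerivAt_integral_of_dominated_loc_of_deriv_le (μ := volume) (𝕜 := ℝ)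
    (F := fun (t : ℝ) x => u x * dirKernel m n h (x - (a + t • h))) (F' := F') (x₀ := 0)
    (bound := fun x => (m * ‖h‖ ^ 2) * (C₁ * ((1 + ‖x‖) ^ (-(N : ℝ)) * |u x|))
      + n * (C₂ * ((1 + ‖x‖) ^ (-(N : ℝ)) * |u x|))) hsn
    (Eventually.of_forall fun t => aestronglyMeasurable_mul_dirKernel m n h hm _)
    (integrable_mul_dirKernel hn h hr hm hW hz (by simpa using ha))
    (by
      have := ((hi₁.const_mul (-(m * ‖h‖ ^ 2))).add (hi₂.const_mul n)).1
      simpa [F', Pi.add_def] using this)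
    (ae_of_all _ fun x t ht => by
      refine (norm_add_le _ _).trans (add_le_add ?_ ?_)
      · rw [norm_mul, norm_neg, Real.norm_of_nonneg (by positivity)]
        gcongr
        exact hb₁ x _ ht
      · rw [norm_mul, Real.norm_of_nonneg (by positivity)]
        gcongr
        exact hb₂ x _ ht)
    (((hW.const_mul C₁).const_mul _).add ((hW.const_mul C₂).const_mul _))
    (ae_of_all _ fun x t ht => by
      by_cases hx : u x = 0
      · simpa [hx, F'] using hasDerivAt_const t (0 : ℝ)
      have hne : (x - a) - t • h ≠ 0 := by
        intro h'
        have h1 := hz x hx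
        have h2 : x = a + t • h := by rwa [sub_sub, sub_eq_zero] at h'
        have h3 : ‖a + t • h - x₀‖ < r := by simpa [hs, dist_eq_norm] using ht
        rw [← h2] at h3
        linarith
      have h4 := (hasDerivAt_dirKernel m n h (x - a) t hne).const_mul (u x)
      simp only [sub_sub] at h4
      refine h4.congr_deriv ?_
      simp only [F']
      ring_nf)
  have hzero : HasDerivAt (fun t : ℝ => ∫ x, u x * dirKernel m n h (x - (a + t • h))) 0 0 :=
    (hasDerivAt_const (0 : ℝ) (0 : ℝ)).congr_of_eventuallyEq
      (eventually_of_mem hsn fun t ht => h0 _ ht)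
  have := key.2.unique hzero
  simp only [F', zero_smul, add_zero] at this
  rwa [integral_add (hi₁.const_mul _) (hi₂.const_mul _), integral_const_mul,
    integral_const_mul] at this

lemma sum_dirKernel_two {N : ℕ} (n : ℕ) (v : EuclideanSpace ℝ (Fin N)) (hv : v ≠ 0) :
    ∑ i, dirKernel 2 (n + 2) (EuclideanSpace.basisFun (Fin N) ℝ i) v = dirKernel 0 n 0 v := by
  have hpos : 0 < ‖v‖ := norm_pos_iff.2 hv
  unfold dirKernel
  rw [← Finset.sum_mul]
  rw [(EuclideanSpace.basisFun (Fin N) ℝ).sum_sq_inner_left v, pow_zero, one_mul, pow_add]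
  field_simp

lemma dirKernel_zero_left {N : ℕ} (n : ℕ) (h h' v : EuclideanSpace ℝ (Fin N)) :
    dirKernel 0 n h v = dirKernel 0 n h' v := by simp [dirKernel]

/-- Vanishing of `u * ‖·‖ ^ (-n)` on a ball passes to `u * ‖·‖ ^ (-(n + 2))`, by taking the
Laplacian. -/
lemma integral_dirKernel_zero_succ {N n : ℕ} (hN : 1 ≤ N) (hn : N ≤ n)
    {r : ℝ} (hr : 0 < r) {x₀ : EuclideanSpace ℝ (Fin N)} {u : EuclideanSpace ℝ (Fin N) → ℝ}
    (hm : AEStronglyMeasurable u volume)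
    (hW : Integrable (fun x => (1 + ‖x‖) ^ (-(N : ℝ)) * |u x|) volume)
    (hz : ∀ x, u x ≠ 0 → 2 * r ≤ ‖x - x₀‖)
    (h0 : ∀ h, ∀ a ∈ ball x₀ r, ∫ x, u x * dirKernel 0 n h (x - a) = 0)
    (h : EuclideanSpace ℝ (Fin N)) {a : EuclideanSpace ℝ (Fin N)} (ha : a ∈ ball x₀ r) :
    ∫ x, u x * dirKernel 0 (n + 2) h (x - a) = 0 := by
  have hn0 : (0 : ℝ) < n := by exact_mod_cast (by omega : 0 < n)
  have h1 : ∀ h, ∀ a ∈ ball x₀ r, ∫ x, u x * dirKernel 1 (n + 2) h (x - a) = 0 := by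
    intro h a ha
    have := integral_deriv_dirKernel_eq_zero (m := 0) (n := n) (by omega) h hr hm hW hz (h0 h) ha
    simpa [hn0.ne'] using this
  have h2 : ∀ i, -(∫ x, u x * dirKernel 0 (n + 2) h (x - a)) + ((n + 2 : ℕ) : ℝ) *
      ∫ x, u x * dirKernel 2 (n + 2 + 2) (EuclideanSpace.basisFun (Fin N) ℝ i) (x - a) = 0 := by
    intro i
    have := integral_deriv_dirKernel_eq_zero (m := 1) (n := n + 2) (by omega)
      (EuclideanSpace.basisFun (Fin N) ℝ i) hr hm hW hz (h1 _) ha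
    rw [(EuclideanSpace.basisFun (Fin N) ℝ).norm_eq_one] at this
    simpa [dirKernel_zero_left _ _ h] using this
  have h3 := Finset.sum_congr (rfl : (Finset.univ : Finset (Fin N)) = _) fun i _ => h2 i
  have hsum : ∑ i, ∫ x, u x * dirKernel 2 (n + 2 + 2) (EuclideanSpace.basisFun (Fin N) ℝ i) (x - a)
      = ∫ x, u x * dirKernel 0 (n + 2) h (x - a) := by
    rw [← integral_finsetSum _ fun i _ =>
      integrable_mul_dirKernel (by omega) _ hr hm hW hz ha]
    refine integral_congr_ae (ae_of_all _ fun x => ?_)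
    by_cases hx : u x = 0
    · simp [hx]
    have hne : x - a ≠ 0 := by
      intro h'
      have h4 := hz x hx
      rw [sub_eq_zero.1 h'] at h4
      have h5 : ‖a - x₀‖ < r := by simpa [dist_eq_norm] using ha
      linarith
    simp only
    rw [← Finset.mul_sum, sum_dirKernel_two _ _ hne, dirKernel_zero_left _ 0 h]
  rw [Finset.sum_add_distrib, ← Finset.mul_sum, hsum] at h3
  simp only [Finset.sum_const, Finset.card_univ, Fintype.card_fin, nsmul_eq_mul,
    mul_zero] at h3
  have h6 : ((n : ℝ) + 2 - N) * ∫ x, u x * dirKernel 0 (n + 2) h (x - a) = 0 := by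
    push_cast at h3
    linarith
  refine (mul_eq_zero.1 h6).resolve_left ?_
  have : (N : ℝ) ≤ n := by exact_mod_cast hn
  linarith

lemma integral_dirKernel_eq_zero {N : ℕ} (hN : 1 ≤ N)
    {r : ℝ} (hr : 0 < r) {x₀ : EuclideanSpace ℝ (Fin N)} {u : EuclideanSpace ℝ (Fin N) → ℝ}
    (hm : AEStronglyMeasurable u volume)
    (hW : Integrable (fun x => (1 + ‖x‖) ^ (-(N : ℝ)) * |u x|) volume)
    (hz : ∀ x, u x ≠ 0 → 2 * r ≤ ‖x - x₀‖)
    (h0 : ∀ a ∈ ball x₀ r, ∫ x, u x * (‖x - a‖ ^ N)⁻¹ = 0) (m : ℕ) :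
    ∀ k, m ≤ k → ∀ h, ∀ a ∈ ball x₀ r, ∫ x, u x * dirKernel m (N + 2 * k) h (x - a) = 0 := by
  induction m using Nat.strong_induction_on with
  | _ m ih =>
    rcases m with _ | m
    · intro k _
      induction k with
      | zero => simpa [dirKernel] using h0
      | succ k ihk =>
        intro h a ha
        exact integral_dirKernel_zero_succ (n := N + 2 * k) hN (by omega) hr hm hW hz
          (ihk (by omega)) h ha
    · intro k hk h a ha
      obtain ⟨k, rfl⟩ : ∃ j, k = j + 1 := ⟨k - 1, by omega⟩
      have h1 := integral_deriv_dirKernel_eq_zero (m := m) (n := N + 2 * k) (by omega) h hr hm hW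
        hz (ih m (by omega) k (by omega) h) ha
      rw [ih (m - 1) (by omega) k (by omega) h a ha, mul_zero, zero_add] at h1
      refine (mul_eq_zero.1 h1).resolve_left ?_
      exact_mod_cast (by omega : N + 2 * k ≠ 0)

/-- An integrable density is determined by its moments after a bounded injective change of
variables. -/
lemma ae_eq_zero_of_moments_eq_zero {N : ℕ} {w : EuclideanSpace ℝ (Fin N) → ℝ}
    (hw : Integrable w volume) {Φ Ψ : EuclideanSpace ℝ (Fin N) → EuclideanSpace ℝ (Fin N)}
    (hΦ : Measurable Φ) (hΨ : Measurable Ψ) (hΨΦ : ∀ x, Ψ (Φ x) = x) {R : ℝ}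
    (hR : ∀ x, w x ≠ 0 → ‖Φ x‖ ≤ R)
    (hmom : ∀ (h : EuclideanSpace ℝ (Fin N)) (m : ℕ), ∫ x, w x * inner ℝ (Φ x) h ^ m = 0) :
    ∀ᵐ x, w x = 0 := by
  have hexp : ∀ h : EuclideanSpace ℝ (Fin N),
      ∫ x, (w x : ℂ) * Complex.exp (inner ℝ (Φ x) h * Complex.I) = 0 := by
    intro h
    have hb : ∀ (m : ℕ) x, ‖(w x : ℂ) * ((inner ℝ (Φ x) h * Complex.I) ^ m / (m.factorial : ℂ))‖
        ≤ |w x| * ((R * ‖h‖) ^ m / m.factorial) := by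
      intro m x
      by_cases hx : w x = 0
      · simp [hx]
      have : |inner ℝ (Φ x) h| ≤ R * ‖h‖ := (abs_real_inner_le_norm _ _).trans (by
        gcongr; exact hR x hx)
      simp only [norm_mul, norm_div, norm_pow, Complex.norm_real, Complex.norm_I, mul_one,
        Real.norm_eq_abs, Complex.norm_natCast]
      gcongr
    have hmeas : ∀ m : ℕ, AEStronglyMeasurable (fun x => (w x : ℂ) *
        ((inner ℝ (Φ x) h * Complex.I) ^ m / (m.factorial : ℂ))) volume := fun m =>
      (Complex.continuous_ofReal.comp_aestronglyMeasurable hw.1).mul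
        (Measurable.aestronglyMeasurable (by fun_prop))
    have hintg : ∀ m : ℕ, Integrable (fun x => (w x : ℂ) *
        ((inner ℝ (Φ x) h * Complex.I) ^ m / (m.factorial : ℂ))) volume := fun m =>
      (hw.abs.mul_const _).mono' (hmeas m) (ae_of_all _ (hb m))
    have hsum := hasSum_integral_of_summable_integral_norm hintg (by
      refine Summable.of_nonneg_of_le (fun m => integral_nonneg fun x => norm_nonneg _)
        (fun m => integral_mono (hintg m).norm (hw.abs.mul_const _) (hb m)) ?_
      simp_rw [integral_mul_const]
      exact (Real.summable_pow_div_factorial _).mul_left _)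
    have hterm : ∀ m : ℕ, ∫ x, (w x : ℂ) *
        ((inner ℝ (Φ x) h * Complex.I) ^ m / (m.factorial : ℂ)) = 0 := by
      intro m
      have : ∀ x, (w x : ℂ) * ((inner ℝ (Φ x) h * Complex.I) ^ m / (m.factorial : ℂ))
          = ((w x * inner ℝ (Φ x) h ^ m : ℝ) : ℂ) * (Complex.I ^ m / (m.factorial : ℂ)) := by
        intro x; push_cast; ring
      simp_rw [this]
      rw [integral_mul_const, integral_complex_ofReal, hmom]
      simp
    simp_rw [hterm] at hsum
    have h1 := hsum.unique hasSum_zero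
    rw [← h1]
    refine integral_congr_ae (ae_of_all _ fun x => ?_)
    simp only
    rw [tsum_mul_left, Complex.exp_eq_exp_ℂ, NormedSpace.exp_eq_tsum_div]
  have hofReal : AEMeasurable (fun x => ENNReal.ofReal (w x)) volume :=
    hw.1.aemeasurable.ennreal_ofReal
  have hofReal' : AEMeasurable (fun x => ENNReal.ofReal (-w x)) volume :=
    hw.1.aemeasurable.neg.ennreal_ofReal
  have hfin := isFiniteMeasure_withDensity_ofReal hw.2
  have hfin' : IsFiniteMeasure (volume.withDensity fun x => ENNReal.ofReal (-w x)) :=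
    isFiniteMeasure_withDensity_ofReal hw.neg.2
  have hchar : ∀ (f : EuclideanSpace ℝ (Fin N) → ℝ), Integrable f volume → ∀ h,
      charFun ((volume.withDensity fun x => ENNReal.ofReal (f x)).map Φ) h
        = ∫ x, ((max (f x) 0 : ℝ) : ℂ) * Complex.exp (inner ℝ (Φ x) h * Complex.I) := by
    intro f hf h
    rw [charFun_apply, integral_map hΦ.aemeasurable
      (Measurable.aestronglyMeasurable (by fun_prop)),
      integral_withDensity_eq_integral_toReal_smul₀ hf.1.aemeasurable.ennreal_ofReal
        (ae_of_all _ fun x => ENNReal.ofReal_lt_top)]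
    simp [ENNReal.toReal_ofReal']
  have hintg : ∀ (f : EuclideanSpace ℝ (Fin N) → ℝ), Integrable f volume → ∀ h,
      Integrable (fun x => ((max (f x) 0 : ℝ) : ℂ) *
        Complex.exp (inner ℝ (Φ x) h * Complex.I)) volume := by
    intro f hf h
    refine hf.pos_part.ofReal.mul_bdd (c := 1) (Measurable.aestronglyMeasurable (by fun_prop))
      (ae_of_all _ fun x => ?_)
    rw [Complex.norm_exp_ofReal_mul_I]
  have hmap : (volume.withDensity fun x => ENNReal.ofReal (w x)).map Φ
      = (volume.withDensity fun x => ENNReal.ofReal (-w x)).map Φ := by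
    refine Measure.ext_of_charFun (funext fun h => ?_)
    rw [hchar w hw, hchar (fun x => -w x) hw.neg, ← sub_eq_zero,
      ← integral_sub (hintg w hw h) (hintg (fun x => -w x) hw.neg h), ← hexp h]
    refine integral_congr_ae (ae_of_all _ fun x => ?_)
    simp only
    rw [← sub_mul, ← Complex.ofReal_sub, max_zero_sub_eq_self]
  have hmap' := congrArg (Measure.map Ψ) hmap
  have hid : Ψ ∘ Φ = id := funext hΨΦ
  rw [Measure.map_map hΨ hΦ, Measure.map_map hΨ hΦ, hid, Measure.map_id, Measure.map_id,
    withDensity_eq_iff_of_sigmaFinite hofReal hofReal'] at hmap'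
  filter_upwards [hmap'] with x hx
  rcases le_total 0 (w x) with h | h
  · rw [ENNReal.ofReal_of_nonpos (neg_nonpos.2 h), ENNReal.ofReal_eq_zero] at hx
    exact le_antisymm hx h
  · rw [ENNReal.ofReal_of_nonpos h, eq_comm, ENNReal.ofReal_eq_zero] at hx
    linarith

/-- A function whose Riesz-type potential with kernel `‖x - a‖ ^ (-N)` vanishes for all `a` in a
ball away from its support is zero. -/
lemma ae_eq_zero_of_integral_inv_norm_pow_eq_zero {N : ℕ} (hN : 1 ≤ N)
    {r : ℝ} (hr : 0 < r) {x₀ : EuclideanSpace ℝ (Fin N)} {u : EuclideanSpace ℝ (Fin N) → ℝ}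
    (hm : AEStronglyMeasurable u volume)
    (hW : Integrable (fun x => (1 + ‖x‖) ^ (-(N : ℝ)) * |u x|) volume)
    (hz : ∀ x, u x ≠ 0 → 2 * r ≤ ‖x - x₀‖)
    (h0 : ∀ a ∈ ball x₀ r, ∫ x, u x * (‖x - a‖ ^ N)⁻¹ = 0) : ∀ᵐ x, u x = 0 := by
  have hx₀ : x₀ ∈ ball x₀ r := mem_ball_self hr
  have hw : ∀ᵐ x, u x * (‖x - x₀‖ ^ N)⁻¹ = 0 := by
    refine ae_eq_zero_of_moments_eq_zero (R := (2 * r)⁻¹)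
      (Φ := fun x => (‖x - x₀‖ ^ 2)⁻¹ • (x - x₀)) (Ψ := fun y => x₀ + (‖y‖ ^ 2)⁻¹ • y)
      ?_ (by fun_prop) (by fun_prop) (fun x => ?_) (fun x hx => ?_) fun h m => ?_
    · simpa [dirKernel] using
        integrable_mul_dirKernel (m := 0) (n := N) (by omega) 0 hr hm hW hz hx₀
    · by_cases hx : x = x₀
      · simp [hx]
      have hpos : 0 < ‖x - x₀‖ := norm_pos_iff.2 (sub_ne_zero.2 hx)
      simp only [norm_smul, smul_smul, norm_inv, norm_pow, norm_norm]
      rw [show ((((‖x - x₀‖ ^ 2)⁻¹ * ‖x - x₀‖) ^ 2)⁻¹ * (‖x - x₀‖ ^ 2)⁻¹) = 1 by field_simp]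
      simp
    · have h1 := hz x (left_ne_zero_of_mul hx)
      have hpos : 0 < ‖x - x₀‖ := by linarith
      simp only [norm_smul, norm_inv, norm_pow, norm_norm]
      rw [show (‖x - x₀‖ ^ 2)⁻¹ * ‖x - x₀‖ = ‖x - x₀‖⁻¹ by field_simp]
      gcongr
    · rw [← integral_dirKernel_eq_zero hN hr hm hW hz h0 m m le_rfl h x₀ hx₀]
      refine integral_congr_ae (ae_of_all _ fun x => ?_)
      simp only [dirKernel, inner_smul_left, mul_pow, pow_add, pow_mul, mul_inv]
      simp
      ring
  filter_upwards [hw] with x hx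
  by_contra hux
  have h1 := hz x hux
  have hpos : 0 < ‖x - x₀‖ := by linarith
  exact hux ((mul_eq_zero.1 hx).resolve_right (by positivity))

lemma continuousOn_integral_inv_norm_pow {N : ℕ}
    {r : ℝ} (hr : 0 < r) {x₀ : EuclideanSpace ℝ (Fin N)} {u : EuclideanSpace ℝ (Fin N) → ℝ}
    (hm : AEStronglyMeasurable u volume)
    (hW : Integrable (fun x => (1 + ‖x‖) ^ (-(N : ℝ)) * |u x|) volume)
    (hz : ∀ x, u x ≠ 0 → 2 * r ≤ ‖x - x₀‖) :
    ContinuousOn (fun a => ∫ x, u x * (‖x - a‖ ^ N)⁻¹) (ball x₀ r) := by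
  obtain ⟨C, -, hb⟩ := abs_mul_dirKernel_sub_le (m := 0) (n := N) (by omega) 0 hr x₀ hz
  simp only [dirKernel, pow_zero, one_mul] at hb
  refine continuousOn_of_dominated (fun a _ => ?_) (fun a ha => ae_of_all _ fun x => hb x a ha)
    (hW.const_mul C) (ae_of_all _ fun x => ?_)
  · simpa [dirKernel] using aestronglyMeasurable_mul_dirKernel 0 N 0 hm a
  · by_cases hx : u x = 0
    · simp [hx, continuousOn_const]
    refine continuousOn_const.mul (ContinuousOn.inv₀ (by fun_prop) fun a ha => ?_)
    have h1 := hz x hx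
    have h2 : ‖a - x₀‖ < r := by simpa [dist_eq_norm] using ha
    have h3 : ‖x - x₀‖ ≤ ‖x - a‖ + ‖a - x₀‖ := norm_sub_le_norm_sub_add_norm_sub ..
    have : 0 < ‖x - a‖ := by linarith
    positivity

lemma integrableOn_sub_mul_norm_rpow {N : ℕ} (hN : 1 ≤ N) {φ : EuclideanSpace ℝ (Fin N) → ℝ}
    {L : NNReal} (hφ : LipschitzWith L φ) (x : EuclideanSpace ℝ (Fin N)) :
    IntegrableOn (fun y => (φ x - φ (x + y)) * ‖y‖ ^ (-(N : ℝ))) (ball 0 1) := by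
  have : Nonempty (Fin N) := ⟨⟨0, hN⟩⟩
  have hdom : IntegrableOn (fun y : EuclideanSpace ℝ (Fin N) => ‖y‖ * ‖y‖ ^ (-(N : ℝ)))
      (ball 0 1) := by
    rw [integrableOn_fun_norm_addHaar volume (f := fun t : ℝ => t * t ^ (-(N : ℝ)))]
    refine (integrableOn_const (C := (1 : ℝ)) (by simp)).congr_fun (fun t ht => ?_)
      measurableSet_Ioo
    have ht0 : 0 < t := ht.1
    simp only [finrank_euclideanSpace_fin, smul_eq_mul]
    rw [← mul_assoc, ← pow_succ, Nat.sub_add_cancel hN, Real.rpow_neg ht0.le, Real.rpow_natCast,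
      mul_inv_cancel₀ (by positivity)]
  have hcont := hφ.continuous
  refine (hdom.const_mul L).mono' (Measurable.aestronglyMeasurable ?_) (ae_of_all _ fun y => ?_)
  · have := hcont.measurable
    fun_prop
  · have h1 := hφ.dist_le_mul x (x + y)
    simp only [dist_eq_norm, sub_add_cancel_left, norm_neg] at h1
    rw [norm_mul, Real.norm_of_nonneg (by positivity : 0 ≤ ‖y‖ ^ (-(N : ℝ))), ← mul_assoc]
    gcongr

/-- The principal value in the definition of the logarithmic Laplacian exists. -/
lemma tendsto_setIntegral_annulus_s12 {N : ℕ} (hN : 1 ≤ N) {φ : EuclideanSpace ℝ (Fin N) → ℝ}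
    {L : NNReal} (hφ : LipschitzWith L φ) (x : EuclideanSpace ℝ (Fin N)) :
    Tendsto (fun ε : ℝ => ∫ y in {y : EuclideanSpace ℝ (Fin N) | ε ≤ ‖y‖ ∧ ‖y‖ < 1},
        (φ x - φ (x + y)) * ‖y‖ ^ (-(N : ℝ))) (𝓝[>] (0 : ℝ))
      (𝓝 (∫ y in ball 0 1, (φ x - φ (x + y)) * ‖y‖ ^ (-(N : ℝ)))) := by
  have hintg := integrableOn_sub_mul_norm_rpow hN hφ x
  have hS : ∀ ε : ℝ, MeasurableSet {y : EuclideanSpace ℝ (Fin N) | ε ≤ ‖y‖ ∧ ‖y‖ < 1} :=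
    fun ε => (measurableSet_le measurable_const measurable_norm).inter
      (measurableSet_lt measurable_norm measurable_const)
  have hsub : ∀ ε : ℝ, {y : EuclideanSpace ℝ (Fin N) | ε ≤ ‖y‖ ∧ ‖y‖ < 1} ⊆ ball 0 1 :=
    fun ε y hy => by simpa using hy.2
  simp_rw [← integral_indicator (hS _), ← integral_indicator measurableSet_ball]
  refine tendsto_integral_filter_of_dominated_convergence
    (fun y => ‖(ball 0 1).indicator (fun y => (φ x - φ (x + y)) * ‖y‖ ^ (-(N : ℝ))) y‖)
    (Eventually.of_forall fun ε => ?_) (Eventually.of_forall fun ε => ae_of_all _ fun y => ?_)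
    (hintg.integrable_indicator measurableSet_ball).norm (ae_of_all _ fun y => ?_)
  · exact ((hintg.mono_set (hsub ε)).integrable_indicator (hS ε)).1
  · exact norm_indicator_le_of_subset (hsub ε) _ _
  · refine tendsto_const_nhds.congr' ?_
    rcases eq_or_ne y 0 with rfl | hy
    · refine Eventually.of_forall fun ε => ?_
      simp [Set.indicator]
    · filter_upwards [nhdsWithin_le_nhds (Iio_mem_nhds (norm_pos_iff.2 hy))] with ε hε
      have hε' : ε ≤ ‖y‖ := le_of_lt hε
      simp [Set.indicator, hε']

/-- The pointwise logarithmic Laplacian of a function vanishing near `x`. -/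
lemma logLaplacian_eq_of_far {N : ℕ} {φ : EuclideanSpace ℝ (Fin N) → ℝ}
    (hφc : Continuous φ) (hφs : HasCompactSupport φ) {r : ℝ} (hr : 0 < r)
    {x : EuclideanSpace ℝ (Fin N)} (hx : ∀ z, φ z ≠ 0 → r ≤ ‖x - z‖) :
    (∫ y in ball 0 1, (φ x - φ (x + y)) * ‖y‖ ^ (-(N : ℝ)))
      - (∫ y in {y : EuclideanSpace ℝ (Fin N) | 1 ≤ ‖y‖}, φ (x + y) * ‖y‖ ^ (-(N : ℝ)))
      = -∫ z, φ z * (‖x - z‖ ^ N)⁻¹ := by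
  have hφx : φ x = 0 := by
    by_contra h
    have := hx x h
    simp at this
    linarith
  have hcompl : {y : EuclideanSpace ℝ (Fin N) | 1 ≤ ‖y‖} = (ball 0 1)ᶜ := by
    ext y; simp
  have hintg : Integrable (fun y => φ (x + y) * ‖y‖ ^ (-(N : ℝ))) volume := by
    have h1 : Integrable (fun y => φ (x + y)) volume :=
      (hφc.integrable_of_hasCompactSupport hφs).comp_add_left x
    refine (h1.norm.mul_const ((r ^ N)⁻¹)).mono' (Measurable.aestronglyMeasurable ?_)
      (ae_of_all _ fun y => ?_)
    · have := hφc.measurable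
      fun_prop
    · rw [norm_mul, Real.norm_of_nonneg (by positivity : 0 ≤ ‖y‖ ^ (-(N : ℝ))),
        Real.rpow_neg (norm_nonneg _), Real.rpow_natCast]
      by_cases hy : φ (x + y) = 0
      · simp [hy]
      have := hx _ hy
      simp only [sub_add_cancel_left, norm_neg] at this
      gcongr
  rw [hcompl, hφx]
  simp only [zero_sub, neg_mul]
  rw [integral_neg, ← neg_add', integral_add_compl measurableSet_ball hintg,
    ← integral_add_left_eq_self (fun z => φ z * (‖x - z‖ ^ N)⁻¹) x]
  simp [Real.rpow_neg]

lemma integral_mul_integral_inv_norm_pow_swap {N : ℕ}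
    {r : ℝ} (hr : 0 < r) {x₀ : EuclideanSpace ℝ (Fin N)} {u : EuclideanSpace ℝ (Fin N) → ℝ}
    (hm : AEStronglyMeasurable u volume)
    (hW : Integrable (fun x => (1 + ‖x‖) ^ (-(N : ℝ)) * |u x|) volume)
    (hz : ∀ x, u x ≠ 0 → 2 * r ≤ ‖x - x₀‖) {φ : EuclideanSpace ℝ (Fin N) → ℝ}
    (hφ : Integrable φ volume) (hφz : ∀ z, φ z ≠ 0 → z ∈ ball x₀ r) :
    ∫ x, u x * ∫ z, φ z * (‖x - z‖ ^ N)⁻¹ = ∫ z, φ z * ∫ x, u x * (‖x - z‖ ^ N)⁻¹ := by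
  obtain ⟨C, -, hb⟩ := abs_mul_dirKernel_sub_le (m := 0) (n := N) (by omega) 0 hr x₀ hz
  simp only [dirKernel, pow_zero, one_mul] at hb
  have hintg : Integrable (Function.uncurry fun x z => u x * (φ z * (‖x - z‖ ^ N)⁻¹))
      (volume.prod volume) := by
    refine ((hW.const_mul C).mul_prod hφ.norm).mono' ?_ (ae_of_all _ fun p => ?_)
    · exact hm.comp_fst.mul (hφ.1.comp_snd.mul (Measurable.aestronglyMeasurable (by fun_prop)))
    · obtain ⟨x, z⟩ := p
      by_cases hp : φ z = 0
      · simp [Function.uncurry, hp]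
      simp only [Function.uncurry]
      rw [mul_left_comm, norm_mul, mul_comm]
      gcongr
      exact hb x z (hφz z hp)
  simp_rw [← integral_const_mul]
  rw [integral_integral_swap hintg]
  simp_rw [mul_left_comm]

/-- weak unique continuation for the logarithmic Laplacian. If
`u ∈ L^1_0(ℝ^N)` vanishes a.e. on a nonempty open set `Ω` and
`∫ u L_Δ φ = 0` for every `φ ∈ C_c^∞(Ω)` (where `Lφ` denotes the pointwise
logarithmic Laplacian of `φ`, encoded via the principal value limit), then
`u = 0` a.e. on `ℝ^N`. -/
theorem stmt12 (N : ℕ) (hN : 1 ≤ N) (u : EuclideanSpace ℝ (Fin N) → ℝ)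
    (hu : MemL10 N u)
    (Ω : Set (EuclideanSpace ℝ (Fin N))) (hΩo : IsOpen Ω) (hΩne : Ω.Nonempty)
    (hvan : ∀ᵐ x : EuclideanSpace ℝ (Fin N), x ∈ Ω → u x = 0)
    (hsol : ∀ (φ Lφ : EuclideanSpace ℝ (Fin N) → ℝ),
      ContDiff ℝ (⊤ : ℕ∞) φ → HasCompactSupport φ → tsupport φ ⊆ Ω →
      (∀ x : EuclideanSpace ℝ (Fin N),
        Tendsto (fun ε : ℝ =>
            cN N * ∫ y in {y : EuclideanSpace ℝ (Fin N) | ε ≤ ‖y‖ ∧ ‖y‖ < 1},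
              (φ x - φ (x + y)) * ‖y‖ ^ (-(N : ℝ)))
          (𝓝[>] (0 : ℝ))
          (𝓝 (Lφ x
            + cN N * (∫ y in {y : EuclideanSpace ℝ (Fin N) | 1 ≤ ‖y‖},
                φ (x + y) * ‖y‖ ^ (-(N : ℝ)))
            - rhoN N * φ x))) →
      (∫ x, u x * Lφ x) = 0) :
    ∀ᵐ x : EuclideanSpace ℝ (Fin N), u x = 0 := by
  obtain ⟨x₀, hx₀⟩ := hΩne
  obtain ⟨R, hR, hball⟩ := Metric.isOpen_iff.1 hΩo x₀ hx₀
  obtain ⟨r, hr, rfl⟩ : ∃ r, 0 < r ∧ R = 2 * r := ⟨R / 2, by positivity, by ring⟩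
  set v : EuclideanSpace ℝ (Fin N) → ℝ := (ball x₀ (2 * r))ᶜ.indicator u with hv
  have huv : ∀ᵐ x, u x = v x := by
    filter_upwards [hvan] with x hx
    by_cases hxb : x ∈ ball x₀ (2 * r)
    · simp [hv, hxb, hx (hball hxb)]
    · rw [hv, Set.indicator_of_mem hxb]
  have hvz : ∀ x, v x ≠ 0 → 2 * r ≤ ‖x - x₀‖ := by
    intro x hx
    have : x ∉ ball x₀ (2 * r) := Set.mem_of_indicator_ne_zero hx
    simpa [dist_eq_norm] using this
  have hvm : AEStronglyMeasurable v volume :=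
    hu.1.aestronglyMeasurable.indicator measurableSet_ball.compl
  have hvW : Integrable (fun x => (1 + ‖x‖) ^ (-(N : ℝ)) * |v x|) volume := by
    refine hu.2.congr ?_
    filter_upwards [huv] with x hx
    rw [hx]
  have hcN : cN N ≠ 0 := by
    have : 0 < (N : ℝ) / 2 := by positivity
    have := Real.Gamma_pos_of_pos this
    unfold cN
    positivity
  have hcont := continuousOn_integral_inv_norm_pow hr hvm hvW hvz
  have hae : ∀ᵐ a, a ∈ ball x₀ r → ∫ x, v x * (‖x - a‖ ^ N)⁻¹ = 0 := by
    refine isOpen_ball.ae_eq_zero_of_integral_contDiff_smul_eq_zero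
      (hcont.locallyIntegrableOn measurableSet_ball) fun φ hφ hφs hφb => ?_
    have hφz : ∀ z, φ z ≠ 0 → z ∈ ball x₀ r := fun z hz => hφb (subset_tsupport φ hz)
    obtain ⟨L, hL⟩ := (hφ.of_le (by simp)).lipschitzWith_of_hasCompactSupport hφs one_ne_zero
    have h := hsol φ (fun x => cN N * (∫ y in ball 0 1, (φ x - φ (x + y)) * ‖y‖ ^ (-(N : ℝ)))
      - cN N * (∫ y in {y : EuclideanSpace ℝ (Fin N) | 1 ≤ ‖y‖}, φ (x + y) * ‖y‖ ^ (-(N : ℝ)))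
      + rhoN N * φ x) hφ hφs
      (hφb.trans ((ball_subset_ball (by linarith)).trans hball)) fun x => by
        rw [show ∀ a b c : ℝ, a - b + c + b - c = a by intros; ring]
        exact (tendsto_setIntegral_annulus_s12 hN hL x).const_mul _
    have hL' : ∀ x, v x ≠ 0 → _ = _ := fun x hx =>
      logLaplacian_eq_of_far hφ.continuous hφs hr (x := x) fun z hz => by
        have h1 := hvz x hx
        have h2 : ‖z - x₀‖ < r := by simpa [dist_eq_norm] using hφz z hz
        have h3 : ‖x - x₀‖ ≤ ‖x - z‖ + ‖z - x₀‖ := norm_sub_le_norm_sub_add_norm_sub ..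
        linarith
    have h' : ∫ x, -cN N * (v x * ∫ z, φ z * (‖x - z‖ ^ N)⁻¹) = 0 := by
      rw [← h]
      refine integral_congr_ae ?_
      filter_upwards [huv] with x hx
      rw [hx]
      by_cases hvx : v x = 0
      · simp [hvx]
      have hφx : φ x = 0 := by
        by_contra hne
        have h1 := hvz x hvx
        have h2 : ‖x - x₀‖ < r := by simpa [dist_eq_norm] using hφz x hne
        linarith
      rw [hφx, mul_zero, add_zero, ← mul_sub, ← hφx, hL' x hvx]
      ring
    rw [integral_const_mul, integral_mul_integral_inv_norm_pow_swap hr hvm hvW hvz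
      (hφ.continuous.integrable_of_hasCompactSupport hφs) hφz] at h'
    simpa [hcN] using h'
  have hzero : EqOn (fun a => ∫ x, v x * (‖x - a‖ ^ N)⁻¹) (fun _ => 0) (ball x₀ r) :=
    Measure.eqOn_open_of_ae_eq ((ae_restrict_iff' measurableSet_ball).2 hae) isOpen_ball hcont
      continuousOn_const
  filter_upwards [huv, ae_eq_zero_of_integral_inv_norm_pow_eq_zero hN hr hvm hvW hvz
    fun a ha => hzero ha] with x hx hx'
  rw [hx, hx']
end
end
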